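/- arXiv:2406.12884 — 3 statements merged into one kernel-verified Lean document; each statement's English description precedes it below -/
import Mathlib

section
/- Let $K$ be a field and $n$ a positive integer such that either ($n\geq 4$ and $\mathrm{char}\,K\neq 3$) or $n\geq 5$. Then the group $\mathrm{ATAut}(M_n)$ of all almost tame automorphisms of the free metabelian Lie algebra $M_n$ is generated by the group $GL_n(K)$ of linear automorphisms together with the quadratic automorphism $(x_1+[x_2,x_3],x_2,\ldots,x_n)$ and the cubic automorphism $(x_1+[[x_2,x_3],x_1],x_2,\ldots,x_n)$. -/
noncomputable section

/-- The free metabelian Lie algebra of rank `n` over `K`: the quotient of the free Lie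
algebra on `n` generators by its second derived ideal. -/
abbrev FreeMetabelianLie (K : Type) [Field K] (n : ℕ) : Type :=
  FreeLieAlgebra K (Fin n) ⧸ LieAlgebra.derivedSeries K (FreeLieAlgebra K (Fin n)) 2

/-- The free generators `x₁, …, xₙ` of the free metabelian Lie algebra. -/
def xg (K : Type) [Field K] (n : ℕ) (i : Fin n) : FreeMetabelianLie K n :=
  LieSubmodule.Quotient.mk (N := LieAlgebra.derivedSeries K (FreeLieAlgebra K (Fin n)) 2)
    (FreeLieAlgebra.of K i)

/-- The group structure on Lie algebra automorphisms, with `(e * f) x = e (f x)`. -/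
instance lieAutGroup (K : Type) [CommRing K] (L : Type) [LieRing L] [LieAlgebra K L] :
    Group (L ≃ₗ⁅K⁆ L) where
  mul e f := f.trans e
  one := LieEquiv.refl
  inv := LieEquiv.symm
  mul_assoc _ _ _ := LieEquiv.ext fun _ => rfl
  one_mul _ := LieEquiv.ext fun _ => rfl
  mul_one _ := LieEquiv.ext fun _ => rfl
  inv_mul_cancel e := LieEquiv.ext fun x => e.symm_apply_apply x

/-- An automorphism of the free metabelian Lie algebra is elementary if it maps some `xᵢ` to
`α • xᵢ + f`, with `0 ≠ α ∈ K` and `f` in the subalgebra generated by the other generators,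
and fixes all other generators. -/
def IsElementaryAut (K : Type) [Field K] (n : ℕ)
    (φ : FreeMetabelianLie K n ≃ₗ⁅K⁆ FreeMetabelianLie K n) : Prop :=
  ∃ (i : Fin n) (α : K) (f : FreeMetabelianLie K n), α ≠ 0 ∧
    f ∈ LieSubalgebra.lieSpan K (FreeMetabelianLie K n) (xg K n '' {j | j ≠ i}) ∧
    φ (xg K n i) = α • xg K n i + f ∧ ∀ j : Fin n, j ≠ i → φ (xg K n j) = xg K n j

/-- A tame automorphism is one in the subgroup generated by the elementary automorphisms. -/
def IsTame (K : Type) [Field K] (n : ℕ)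
    (φ : FreeMetabelianLie K n ≃ₗ⁅K⁆ FreeMetabelianLie K n) : Prop :=
  φ ∈ Subgroup.closure {ψ | IsElementaryAut K n ψ}

/-- A Chein automorphism (one-row transformation) moves only one generator. -/
def IsCheinAut (K : Type) [Field K] (n : ℕ)
    (φ : FreeMetabelianLie K n ≃ₗ⁅K⁆ FreeMetabelianLie K n) : Prop :=
  ∃ i : Fin n, ∀ j : Fin n, j ≠ i → φ (xg K n j) = xg K n j

/-- An almost tame automorphism is one in the subgroup generated by Chein automorphisms. -/
def IsAlmostTame (K : Type) [Field K] (n : ℕ)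
    (φ : FreeMetabelianLie K n ≃ₗ⁅K⁆ FreeMetabelianLie K n) : Prop :=
  φ ∈ Subgroup.closure {ψ | IsCheinAut K n ψ}

/-- `monoSet K n k` is the set of right-normed Lie monomials of degree `k+1` in the
generators. -/
def monoSet (K : Type) [Field K] (n : ℕ) : ℕ → Set (FreeMetabelianLie K n)
  | 0 => Set.range (xg K n)
  | k + 1 => {z | ∃ u ∈ monoSet K n k, ∃ i : Fin n, z = ⁅u, xg K n i⁆}

/-- `gradePiece K n k` (for `k ≥ 1`) is the homogeneous component `L_k` of the standard
grading: the linear span of the Lie monomials of degree `k` in the generators. -/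
def gradePiece (K : Type) [Field K] (n : ℕ) (k : ℕ) : Submodule K (FreeMetabelianLie K n) :=
  Submodule.span K (monoSet K n (k - 1))

/-- The automorphism `φ = (l₁ + m₁, …, lₙ + mₙ)` (with `lᵢ` linear, `mᵢ ∈ [M,M]`) has lower
degree `≥ d`: each `φ(xᵢ)` lies in `L₁ ⊕ (⨆ k ≥ d, L_k)`. -/
def AutLdegGE (K : Type) [Field K] (n : ℕ)
    (φ : FreeMetabelianLie K n ≃ₗ⁅K⁆ FreeMetabelianLie K n) (d : ℕ) : Prop :=
  ∀ i : Fin n, φ (xg K n i) ∈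
    gradePiece K n 1 ⊔ ⨆ (k : ℕ) (_ : d ≤ k), gradePiece K n k

/-- The action of a polynomial `a ∈ U = K[y₁,…,yₙ]` on `m`; for `m ∈ [M,M]` this is the
canonical `U`-module action on the derived ideal, determined by `m ⬝ yᵢ = ⁅m, xᵢ⁆`. -/
def polyAct (K : Type) [Field K] (n : ℕ) (a : MvPolynomial (Fin n) K)
    (m : FreeMetabelianLie K n) : FreeMetabelianLie K n :=
  ∑ d ∈ a.support, a.coeff d •
    ((List.ofFn fun i : Fin n =>
      (-(LieAlgebra.ad K (FreeMetabelianLie K n) (xg K n i))) ^ (d i)).prod m)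

/-- The polynomial `a` has lower degree `≥ d`: every monomial of `a` has total degree `≥ d`. -/
def PolyLdegGE (K : Type) [Field K] (n : ℕ) (a : MvPolynomial (Fin n) K) (d : ℕ) : Prop :=
  ∀ v ∈ a.support, d ≤ ∑ i, v i

/-- An exponential automorphism: `exp (ad z) = id + ad z` for some `z ∈ [M,M]`. -/
def IsExponentialAut (K : Type) [Field K] (n : ℕ)
    (φ : FreeMetabelianLie K n ≃ₗ⁅K⁆ FreeMetabelianLie K n) : Prop :=
  ∃ z ∈ LieAlgebra.derivedSeries K (FreeMetabelianLie K n) 1,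
    ∀ m : FreeMetabelianLie K n, φ m = m + ⁅z, m⁆

end

section Metabelian

variable {K : Type} [Field K] {n : ℕ}

theorem lieAut_mul_apply {L : Type} [LieRing L] [LieAlgebra K L] (e f : L ≃ₗ⁅K⁆ L) (z : L) :
    (e * f) z = e (f z) := rfl

theorem lieAut_inv_apply_self {L : Type} [LieRing L] [LieAlgebra K L] (e : L ≃ₗ⁅K⁆ L) (z : L) :
    e⁻¹ (e z) = z := e.symm_apply_apply z

theorem lieAut_apply_inv_self {L : Type} [LieRing L] [LieAlgebra K L] (e : L ≃ₗ⁅K⁆ L) (z : L) :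
    e (e⁻¹ z) = z := e.apply_symm_apply z

/-- Universal property: generators may be sent anywhere in a metabelian Lie algebra. -/
theorem exists_lieHom_xg {L : Type} [LieRing L] [LieAlgebra K L]
    (hL : ∀ a b c d : L, ⁅⁅a, b⁆, ⁅c, d⁆⁆ = 0) (f : Fin n → L) :
    ∃ F : FreeMetabelianLie K n →ₗ⁅K⁆ L, ∀ i, F (xg K n i) = f i := by
  let F₀ := FreeLieAlgebra.lift K f
  have hker : ∀ m ∈ LieAlgebra.derivedSeries K (FreeLieAlgebra K (Fin n)) 2, F₀ m = 0 := by
    intro m hm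
    have h2 := LieIdeal.derivedSeries_map_le (f := F₀) 2 (LieIdeal.mem_map hm)
    have h3 : LieAlgebra.derivedSeries K L 2 = ⊥ := by
      have e : LieAlgebra.derivedSeries K L 2
          = ⁅⁅(⊤ : LieIdeal K L), (⊤ : LieIdeal K L)⁆, ⁅(⊤ : LieIdeal K L), (⊤ : LieIdeal K L)⁆⁆ := by
        simp [LieAlgebra.derivedSeriesOfIdeal_succ]
      rw [e, LieSubmodule.lie_eq_bot_iff]
      have key : ∀ y ∈ ⁅(⊤ : LieIdeal K L), (⊤ : LieIdeal K L)⁆, ∀ c d : L, ⁅y, ⁅c, d⁆⁆ = 0 := by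
        intro y hy c d
        rw [← LieSubmodule.mem_toSubmodule, LieSubmodule.lieIdeal_oper_eq_linear_span'] at hy
        induction hy using Submodule.span_induction with
        | mem z hz => obtain ⟨a, -, b, -, rfl⟩ := hz; exact hL a b c d
        | zero => simp
        | add a b _ _ ha hb => rw [add_lie, ha, hb, add_zero]
        | smul t a _ ha => rw [smul_lie, ha, smul_zero]
      intro y hy z hz
      rw [← LieSubmodule.mem_toSubmodule, LieSubmodule.lieIdeal_oper_eq_linear_span'] at hz
      induction hz using Submodule.span_induction with
      | mem z hz => obtain ⟨a, -, b, -, rfl⟩ := hz; exact key y hy a b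
      | zero => simp
      | add a b _ _ ha hb => rw [lie_add, ha, hb, add_zero]
      | smul t a _ ha => rw [lie_smul, ha, smul_zero]
    rw [h3] at h2
    simpa using h2
  let F₁ : FreeMetabelianLie K n →ₗ[K] L :=
    (LieAlgebra.derivedSeries K (FreeLieAlgebra K (Fin n)) 2).toSubmodule.liftQ
      (F₀ : FreeLieAlgebra K (Fin n) →ₗ[K] L) hker
  refine ⟨{ F₁ with map_lie' := ?_ }, fun i => ?_⟩
  · intro a b
    obtain ⟨a, rfl⟩ := LieSubmodule.Quotient.surjective_mk' _ a
    obtain ⟨b, rfl⟩ := LieSubmodule.Quotient.surjective_mk' _ b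
    exact F₀.map_lie a b
  · exact FreeLieAlgebra.lift_of_apply f i

theorem lieHom_ext_xg {L : Type} [LieRing L] [LieAlgebra K L]
    {F G : FreeMetabelianLie K n →ₗ⁅K⁆ L} (h : ∀ i, F (xg K n i) = G (xg K n i)) : F = G := by
  let q : FreeLieAlgebra K (Fin n) →ₗ⁅K⁆ FreeMetabelianLie K n :=
    { (LieSubmodule.Quotient.mk' (LieAlgebra.derivedSeries K (FreeLieAlgebra K (Fin n)) 2) :
        FreeLieAlgebra K (Fin n) →ₗ[K] FreeMetabelianLie K n) with
      map_lie' := fun {_ _} => rfl }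
  have hq : F.comp q = G.comp q := FreeLieAlgebra.hom_ext h
  ext z
  obtain ⟨z, rfl⟩ := LieSubmodule.Quotient.surjective_mk' _ z
  exact LieHom.congr_fun hq z

theorem lie_lie_lie_lie (a b c d : FreeMetabelianLie K n) : ⁅⁅a, b⁆, ⁅c, d⁆⁆ = 0 := by
  obtain ⟨a, rfl⟩ := LieSubmodule.Quotient.surjective_mk' _ a
  obtain ⟨b, rfl⟩ := LieSubmodule.Quotient.surjective_mk' _ b
  obtain ⟨c, rfl⟩ := LieSubmodule.Quotient.surjective_mk' _ c
  obtain ⟨d, rfl⟩ := LieSubmodule.Quotient.surjective_mk' _ d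
  refine (LieSubmodule.Quotient.mk_eq_zero
    (N := LieAlgebra.derivedSeries K (FreeLieAlgebra K (Fin n)) 2)
    (m := ⁅⁅a, b⁆, ⁅c, d⁆⁆)).2 ?_
  simp only [LieAlgebra.derivedSeriesOfIdeal_succ, LieAlgebra.derivedSeriesOfIdeal_zero]
  exact LieSubmodule.lie_mem_lie (LieSubmodule.lie_mem_lie trivial trivial)
    (LieSubmodule.lie_mem_lie trivial trivial)

theorem lieAut_ext_xg {e f : FreeMetabelianLie K n ≃ₗ⁅K⁆ FreeMetabelianLie K n}
    (h : ∀ i, e (xg K n i) = f (xg K n i)) : e = f := by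
  have : (e : FreeMetabelianLie K n →ₗ⁅K⁆ FreeMetabelianLie K n) = f := lieHom_ext_xg h
  exact LieEquiv.ext fun z => LieHom.congr_fun this z

/-- Two endomorphisms that are mutually inverse on the generators give an automorphism. -/
theorem exists_lieAut_xg {F G : FreeMetabelianLie K n →ₗ⁅K⁆ FreeMetabelianLie K n}
    (hFG : ∀ i, F (G (xg K n i)) = xg K n i) (hGF : ∀ i, G (F (xg K n i)) = xg K n i) :
    ∃ e : FreeMetabelianLie K n ≃ₗ⁅K⁆ FreeMetabelianLie K n, ∀ z, e z = F z := by
  have h1 : F.comp G = LieHom.id := lieHom_ext_xg hFG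
  have h2 : G.comp F = LieHom.id := lieHom_ext_xg hGF
  exact ⟨{ F with
    invFun := G
    left_inv := fun z => LieHom.congr_fun h2 z
    right_inv := fun z => LieHom.congr_fun h1 z }, fun _ => rfl⟩

/-- The word `[…[[m, x_{l_r}], x_{l_{r-1}}], …, x_{l_1}]` for a list of indices `l`. -/
noncomputable def wordAct (l : List (Fin n)) (m : FreeMetabelianLie K n) : FreeMetabelianLie K n :=
  l.foldr (fun j z => ⁅z, xg K n j⁆) m

@[simp] theorem wordAct_nil (m : FreeMetabelianLie K n) : wordAct [] m = m := rfl

@[simp] theorem wordAct_cons (j : Fin n) (l : List (Fin n)) (m : FreeMetabelianLie K n) :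
    wordAct (j :: l) m = ⁅wordAct l m, xg K n j⁆ := rfl

theorem wordAct_append (l l' : List (Fin n)) (m : FreeMetabelianLie K n) :
    wordAct (l ++ l') m = wordAct l (wordAct l' m) := by
  simp [wordAct]

theorem wordAct_add (l : List (Fin n)) (m m' : FreeMetabelianLie K n) :
    wordAct l (m + m') = wordAct l m + wordAct l m' := by
  induction l with
  | nil => rfl
  | cons j l ih => simp [ih]

theorem wordAct_neg (l : List (Fin n)) (m : FreeMetabelianLie K n) :
    wordAct l (-m) = -wordAct l m := by
  induction l with
  | nil => rfl
  | cons j l ih => simp [ih]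

theorem wordAct_lie_eq_lie (l : List (Fin n)) (a b : FreeMetabelianLie K n) :
    ∃ c d : FreeMetabelianLie K n, wordAct l ⁅a, b⁆ = ⁅c, d⁆ := by
  cases l with
  | nil => exact ⟨a, b, rfl⟩
  | cons j l => exact ⟨_, _, rfl⟩

theorem wordAct_perm {l l' : List (Fin n)} (h : l.Perm l') (a b : FreeMetabelianLie K n) :
    wordAct l ⁅a, b⁆ = wordAct l' ⁅a, b⁆ := by
  induction h with
  | nil => rfl
  | cons j _ ih => simp [ih]
  | swap j k l =>
    obtain ⟨c, d, h⟩ := wordAct_lie_eq_lie l a b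
    have := leibniz_lie ⁅c, d⁆ (xg K n j) (xg K n k)
    rw [lie_lie_lie_lie, ← lie_skew (xg K n j) ⁅⁅c, d⁆, xg K n k⁆] at this
    simp only [wordAct_cons, h]
    exact sub_eq_zero.1 ((sub_eq_add_neg _ _).trans this.symm)
  | trans _ _ ih ih' => exact ih.trans ih'

/-- The span of the words in brackets `[x_j, x_k]` with `j`, `k` satisfying `p`. -/
noncomputable def wordSpan (p : Fin n → Prop) : Submodule K (FreeMetabelianLie K n) :=
  Submodule.span K {z | ∃ (j k : Fin n) (l : List (Fin n)), p j ∧ p k ∧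
    z = wordAct l ⁅xg K n j, xg K n k⁆}

theorem wordAct_mem_wordSpan {p : Fin n → Prop} (l : List (Fin n)) {j k : Fin n}
    (hj : p j) (hk : p k) :
    wordAct l ⁅xg K n j, xg K n k⁆ ∈ wordSpan (K := K) p :=
  Submodule.subset_span ⟨j, k, l, hj, hk, rfl⟩

theorem wordSpan_mono {p q : Fin n → Prop} (h : ∀ i, p i → q i) :
    wordSpan (K := K) p ≤ wordSpan q :=
  Submodule.span_mono fun _ ⟨j, k, l, hj, hk, e⟩ => ⟨j, k, l, h j hj, h k hk, e⟩

theorem lie_xg_mem_wordSpan {p : Fin n → Prop} {m : FreeMetabelianLie K n}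
    (hm : m ∈ wordSpan p) (i : Fin n) : ⁅m, xg K n i⁆ ∈ wordSpan p := by
  induction hm using Submodule.span_induction with
  | mem z hz =>
    obtain ⟨j, k, l, hj, hk, rfl⟩ := hz
    exact wordAct_mem_wordSpan (i :: l) hj hk
  | zero => simp
  | add a b _ _ ha hb => rw [add_lie]; exact add_mem ha hb
  | smul t a _ ha => rw [smul_lie]; exact Submodule.smul_mem _ _ ha

theorem wordAct_mem {p : Fin n → Prop} {m : FreeMetabelianLie K n}
    (hm : m ∈ wordSpan p) (l : List (Fin n)) : wordAct l m ∈ wordSpan p := by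
  induction l with
  | nil => exact hm
  | cons j l ih => exact lie_xg_mem_wordSpan ih j

theorem lie_eq_zero_of_mem_wordSpan {p q : Fin n → Prop} {a b : FreeMetabelianLie K n}
    (ha : a ∈ wordSpan p) (hb : b ∈ wordSpan q) : ⁅a, b⁆ = 0 := by
  induction ha using Submodule.span_induction with
  | mem z hz =>
    obtain ⟨j, k, l, -, -, rfl⟩ := hz
    obtain ⟨c, d, h⟩ := wordAct_lie_eq_lie l (xg K n j) (xg K n k)
    rw [h]
    induction hb using Submodule.span_induction with
    | mem z hz =>
      obtain ⟨j, k, l, -, -, rfl⟩ := hz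
      obtain ⟨c, d, h⟩ := wordAct_lie_eq_lie l (xg K n j) (xg K n k)
      rw [h, lie_lie_lie_lie]
    | zero => simp
    | add a b _ _ ha hb => rw [lie_add, ha, hb, add_zero]
    | smul t a _ ha => rw [lie_smul, ha, smul_zero]
  | zero => simp
  | add a b _ _ ha hb => rw [add_lie, ha, hb, add_zero]
  | smul t a _ ha => rw [smul_lie, ha, smul_zero]

theorem lie_mem_wordSpan_of_decomp {a b s t : FreeMetabelianLie K n}
    (ha : a ∈ Submodule.span K (Set.range (xg K n))) (hs : s ∈ wordSpan fun _ => True)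
    (hb : b ∈ Submodule.span K (Set.range (xg K n))) (ht : t ∈ wordSpan fun _ => True) :
    ⁅a + s, b + t⁆ ∈ wordSpan (K := K) fun _ : Fin n => True := by
  have key : ∀ u ∈ wordSpan (K := K) fun _ : Fin n => True,
      ∀ v ∈ Submodule.span K (Set.range (xg K n)),
        ⁅u, v⁆ ∈ wordSpan (K := K) fun _ : Fin n => True := by
    intro u hu v hv
    induction hv using Submodule.span_induction with
    | mem z hz => obtain ⟨i, rfl⟩ := hz; exact lie_xg_mem_wordSpan hu i
    | zero => simp
    | add a b _ _ ha hb => rw [lie_add]; exact add_mem ha hb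
    | smul t a _ ha => rw [lie_smul]; exact Submodule.smul_mem _ _ ha
  have key2 : ⁅a, b⁆ ∈ wordSpan (K := K) fun _ : Fin n => True := by
    induction ha using Submodule.span_induction with
    | mem z hz =>
      obtain ⟨i, rfl⟩ := hz
      induction hb using Submodule.span_induction with
      | mem z hz => obtain ⟨j, rfl⟩ := hz; exact wordAct_mem_wordSpan [] trivial trivial
      | zero => simp
      | add a b _ _ ha hb => rw [lie_add]; exact add_mem ha hb
      | smul t a _ ha => rw [lie_smul]; exact Submodule.smul_mem _ _ ha
    | zero => simp
    | add a b _ _ ha hb => rw [add_lie]; exact add_mem ha hb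
    | smul t a _ ha => rw [smul_lie]; exact Submodule.smul_mem _ _ ha
  rw [add_lie, lie_add, lie_add, lie_eq_zero_of_mem_wordSpan hs ht, add_zero,
    ← lie_skew a t]
  exact add_mem (add_mem key2 (neg_mem (key t ht a ha))) (key s hs b hb)

/-- Every element is a linear combination of generators plus an element of the derived algebra. -/
theorem exists_linear_add_word (z : FreeMetabelianLie K n) :
    ∃ a ∈ Submodule.span K (Set.range (xg K n)), ∃ s ∈ wordSpan fun _ => True, z = a + s := by
  let T : LieSubalgebra K (FreeMetabelianLie K n) :=
    { Submodule.span K (Set.range (xg K n)) ⊔ wordSpan fun _ => True with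
      lie_mem' := by
        intro y z hy hz
        obtain ⟨a, ha, s, hs, rfl⟩ := Submodule.mem_sup.1 hy
        obtain ⟨b, hb, t, ht, rfl⟩ := Submodule.mem_sup.1 hz
        exact Submodule.mem_sup_right (lie_mem_wordSpan_of_decomp ha hs hb ht) }
  have hx : ∀ i, xg K n i ∈ T := fun i =>
    Submodule.mem_sup_left (Submodule.subset_span ⟨i, rfl⟩)
  obtain ⟨F, hF⟩ := exists_lieHom_xg (K := K) (n := n) (L := T)
    (fun a b c d => Subtype.ext (lie_lie_lie_lie _ _ _ _)) (fun i => ⟨xg K n i, hx i⟩)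
  have h : T.incl.comp F = LieHom.id := lieHom_ext_xg fun i => by simp [hF]
  have hz : z ∈ T := by
    have := LieHom.congr_fun h z
    simp only [LieHom.comp_apply, LieHom.id_apply] at this
    rw [← this]
    exact (F z).2
  obtain ⟨a, ha, s, hs, e⟩ := Submodule.mem_sup.1 hz
  exact ⟨a, ha, s, hs, e.symm⟩

theorem lie_mem_wordSpan (y z : FreeMetabelianLie K n) :
    ⁅y, z⁆ ∈ wordSpan (K := K) fun _ : Fin n => True := by
  obtain ⟨a, ha, s, hs, rfl⟩ := exists_linear_add_word y
  obtain ⟨b, hb, t, ht, rfl⟩ := exists_linear_add_word z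
  exact lie_mem_wordSpan_of_decomp ha hs hb ht

theorem map_mem_wordSpan (F : FreeMetabelianLie K n →ₗ⁅K⁆ FreeMetabelianLie K n)
    {m : FreeMetabelianLie K n} (hm : m ∈ wordSpan fun _ => True) :
    F m ∈ wordSpan (K := K) fun _ : Fin n => True := by
  induction hm using Submodule.span_induction with
  | mem z hz =>
    obtain ⟨j, k, l, -, -, rfl⟩ := hz
    obtain ⟨c, d, h⟩ := wordAct_lie_eq_lie l (xg K n j) (xg K n k)
    rw [h, LieHom.map_lie]
    exact lie_mem_wordSpan _ _
  | zero => simp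
  | add a b _ _ ha hb => rw [map_add]; exact add_mem ha hb
  | smul t a _ ha => rw [map_smul]; exact Submodule.smul_mem _ _ ha

/-- An endomorphism that is the identity modulo the derived algebra fixes all words in brackets of
generators that it fixes. -/
theorem map_eq_self_of_mem_wordSpan {p : Fin n → Prop}
    (F : FreeMetabelianLie K n →ₗ⁅K⁆ FreeMetabelianLie K n)
    (hp : ∀ i, p i → F (xg K n i) = xg K n i)
    (hF : ∀ i, F (xg K n i) - xg K n i ∈ wordSpan fun _ => True)
    {m : FreeMetabelianLie K n} (hm : m ∈ wordSpan p) : F m = m := by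
  induction hm using Submodule.span_induction with
  | mem z hz =>
    obtain ⟨j, k, l, hj, hk, rfl⟩ := hz
    induction l with
    | nil => simp [hp j hj, hp k hk]
    | cons b l ih =>
      have h0 := lie_eq_zero_of_mem_wordSpan (K := K)
        (wordAct_mem_wordSpan (K := K) l (p := p) hj hk) (hF b)
      rw [lie_sub, sub_eq_zero] at h0
      rw [wordAct_cons, LieHom.map_lie, ih, h0]
  | zero => simp
  | add a b _ _ ha hb => rw [map_add, ha, hb]
  | smul t a _ ha => rw [map_smul, ha]

theorem lieAut_inv_apply_of_eq {L : Type} [LieRing L] [LieAlgebra K L] {e : L ≃ₗ⁅K⁆ L} {y z : L}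
    (h : e y = z) : e⁻¹ z = y := by
  rw [← h, lieAut_inv_apply_self]

theorem lieAut_apply_eq_self {ψ : FreeMetabelianLie K n ≃ₗ⁅K⁆ FreeMetabelianLie K n} {i : Fin n}
    {m z : FreeMetabelianLie K n} (hm : m ∈ wordSpan fun _ => True)
    (hi : ψ (xg K n i) = xg K n i + m) (hj : ∀ j, j ≠ i → ψ (xg K n j) = xg K n j)
    (hz : z ∈ wordSpan (· ≠ i)) : ψ z = z := by
  refine map_eq_self_of_mem_wordSpan (p := (· ≠ i))
    (ψ : FreeMetabelianLie K n →ₗ⁅K⁆ FreeMetabelianLie K n) hj (fun j => ?_) hz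
  by_cases h : j = i
  · subst h
    simpa [hi] using hm
  · simp [hj j h]

/-- An automorphism changing a single generator. -/
theorem exists_lieAut_single (j : Fin n) {α : K} (hα : α ≠ 0) (s : FreeMetabelianLie K n)
    (h1 : ∀ F : FreeMetabelianLie K n →ₗ⁅K⁆ FreeMetabelianLie K n,
      F (xg K n j) = α • xg K n j + s → (∀ b, b ≠ j → F (xg K n b) = xg K n b) → F s = s)
    (h2 : ∀ F : FreeMetabelianLie K n →ₗ⁅K⁆ FreeMetabelianLie K n,
      F (xg K n j) = α⁻¹ • (xg K n j - s) → (∀ b, b ≠ j → F (xg K n b) = xg K n b) → F s = s) :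
    ∃ e : FreeMetabelianLie K n ≃ₗ⁅K⁆ FreeMetabelianLie K n,
      e (xg K n j) = α • xg K n j + s ∧ ∀ b, b ≠ j → e (xg K n b) = xg K n b := by
  obtain ⟨F, hF⟩ := exists_lieHom_xg (K := K) (lie_lie_lie_lie (K := K) (n := n))
    (Function.update (xg K n) j (α • xg K n j + s))
  obtain ⟨G, hG⟩ := exists_lieHom_xg (K := K) (lie_lie_lie_lie (K := K) (n := n))
    (Function.update (xg K n) j (α⁻¹ • (xg K n j - s)))
  have hFj : F (xg K n j) = α • xg K n j + s := by simp [hF]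
  have hGj : G (xg K n j) = α⁻¹ • (xg K n j - s) := by simp [hG]
  have hFb : ∀ b, b ≠ j → F (xg K n b) = xg K n b := fun b hb => by simp [hF, hb]
  have hGb : ∀ b, b ≠ j → G (xg K n b) = xg K n b := fun b hb => by simp [hG, hb]
  have hFs := h1 F hFj hFb
  have hGs := h2 G hGj hGb
  obtain ⟨e, he⟩ := exists_lieAut_xg (F := F) (G := G)
    (fun b => by
      by_cases hb : b = j
      · subst hb
        rw [hGj, map_smul, map_sub, hFj, hFs, add_sub_cancel_right, smul_smul,
          inv_mul_cancel₀ hα, one_smul]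
      · rw [hGb b hb, hFb b hb])
    (fun b => by
      by_cases hb : b = j
      · subst hb
        rw [hFj, map_add, map_smul, hGj, hGs, smul_smul, mul_inv_cancel₀ hα, one_smul,
          sub_add_cancel]
      · rw [hFb b hb, hGb b hb])
  exact ⟨e, by rw [he, hFj], fun b hb => by rw [he, hFb b hb]⟩

theorem exists_lieAut_single_of_mem_span (j : Fin n) {α : K} (hα : α ≠ 0)
    {s : FreeMetabelianLie K n} (hs : s ∈ Submodule.span K (xg K n '' {b | b ≠ j})) :
    ∃ e : FreeMetabelianLie K n ≃ₗ⁅K⁆ FreeMetabelianLie K n,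
      e (xg K n j) = α • xg K n j + s ∧ ∀ b, b ≠ j → e (xg K n b) = xg K n b := by
  have h : ∀ F : FreeMetabelianLie K n →ₗ⁅K⁆ FreeMetabelianLie K n,
      (∀ b, b ≠ j → F (xg K n b) = xg K n b) → F s = s := by
    intro F hF
    induction hs using Submodule.span_induction with
    | mem z hz => obtain ⟨b, hb, rfl⟩ := hz; exact hF b hb
    | zero => simp
    | add a b _ _ ha hb => rw [map_add, ha, hb]
    | smul t a _ ha => rw [map_smul, ha]
  exact exists_lieAut_single j hα s (fun F _ hF => h F hF) (fun F _ hF => h F hF)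

theorem exists_lieAut_perm (σ : Equiv.Perm (Fin n)) :
    ∃ e : FreeMetabelianLie K n ≃ₗ⁅K⁆ FreeMetabelianLie K n,
      ∀ i, e (xg K n i) = xg K n (σ i) := by
  obtain ⟨F, hF⟩ := exists_lieHom_xg (K := K) (lie_lie_lie_lie (K := K) (n := n))
    (fun i => xg K n (σ i))
  obtain ⟨G, hG⟩ := exists_lieHom_xg (K := K) (lie_lie_lie_lie (K := K) (n := n))
    (fun i => xg K n (σ.symm i))
  obtain ⟨e, he⟩ := exists_lieAut_xg (F := F) (G := G) (fun i => by simp [hF, hG])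
    (fun i => by simp [hF, hG])
  exact ⟨e, fun i => by rw [he, hF]⟩

/-- `CheinIn G i m` says that the automorphism `x_i ↦ x_i + m`, fixing the other generators, lies in
`G`, where `m` is a combination of words in brackets of generators other than `x_i`. -/
def CheinIn (G : Subgroup (FreeMetabelianLie K n ≃ₗ⁅K⁆ FreeMetabelianLie K n)) (i : Fin n)
    (m : FreeMetabelianLie K n) : Prop :=
  m ∈ wordSpan (· ≠ i) ∧
    ∃ ψ ∈ G, ψ (xg K n i) = xg K n i + m ∧ ∀ j, j ≠ i → ψ (xg K n j) = xg K n j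

variable {G : Subgroup (FreeMetabelianLie K n ≃ₗ⁅K⁆ FreeMetabelianLie K n)}

theorem mem_wordSpan_true {p : Fin n → Prop} {m : FreeMetabelianLie K n} (hm : m ∈ wordSpan p) :
    m ∈ wordSpan (K := K) fun _ : Fin n => True :=
  wordSpan_mono (fun _ _ => trivial) hm

theorem CheinIn.zero (i : Fin n) : CheinIn G i 0 :=
  ⟨zero_mem _, 1, one_mem G, (add_zero _).symm, fun _ _ => rfl⟩

theorem CheinIn.add {i : Fin n} {m m' : FreeMetabelianLie K n} (h : CheinIn G i m)
    (h' : CheinIn G i m') : CheinIn G i (m + m') := by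
  obtain ⟨hm, ψ, hψ, hi, hj⟩ := h
  obtain ⟨hm', ψ', hψ', hi', hj'⟩ := h'
  refine ⟨add_mem hm hm', ψ * ψ', mul_mem hψ hψ', ?_, fun j hji => ?_⟩
  · rw [lieAut_mul_apply, hi', map_add, hi,
      lieAut_apply_eq_self (mem_wordSpan_true hm) hi hj hm', add_assoc]
  · rw [lieAut_mul_apply, hj' j hji, hj j hji]

theorem CheinIn.neg {i : Fin n} {m : FreeMetabelianLie K n} (h : CheinIn G i m) :
    CheinIn G i (-m) := by
  obtain ⟨hm, ψ, hψ, hi, hj⟩ := h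
  refine ⟨neg_mem hm, ψ⁻¹, inv_mem hψ, lieAut_inv_apply_of_eq ?_,
    fun j hji => lieAut_inv_apply_of_eq (hj j hji)⟩
  rw [map_add, map_neg, hi, lieAut_apply_eq_self (mem_wordSpan_true hm) hi hj hm,
    add_neg_cancel_right]

theorem CheinIn.sub {i : Fin n} {m m' : FreeMetabelianLie K n} (h : CheinIn G i m)
    (h' : CheinIn G i m') : CheinIn G i (m - m') :=
  sub_eq_add_neg m m' ▸ h.add h'.neg

theorem CheinIn.conj {i : Fin n} {m : FreeMetabelianLie K n} (h : CheinIn G i m)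
    {g : FreeMetabelianLie K n ≃ₗ⁅K⁆ FreeMetabelianLie K n} (hg : g ∈ G)
    (hgi : g (xg K n i) = xg K n i)
    (hfix : ∀ ψ : FreeMetabelianLie K n ≃ₗ⁅K⁆ FreeMetabelianLie K n,
      (∀ z ∈ wordSpan (· ≠ i), ψ z = z) → (∀ j, j ≠ i → ψ (xg K n j) = xg K n j) →
      ∀ j, j ≠ i → ψ (g⁻¹ (xg K n j)) = g⁻¹ (xg K n j))
    (hm : g m ∈ wordSpan (· ≠ i)) : CheinIn G i (g m) := by
  obtain ⟨hm', ψ, hψ, hi, hj⟩ := h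
  refine ⟨hm, g * ψ * g⁻¹, mul_mem (mul_mem hg hψ) (inv_mem hg), ?_, fun j hji => ?_⟩
  · rw [lieAut_mul_apply, lieAut_mul_apply, lieAut_inv_apply_of_eq hgi, hi, map_add, hgi]
  · rw [lieAut_mul_apply, lieAut_mul_apply,
      hfix ψ (fun z hz => lieAut_apply_eq_self (mem_wordSpan_true hm') hi hj hz) hj j hji,
      lieAut_apply_inv_self]

/-- Conjugation by a linear substitution `x_j ↦ α x_j + β x_b`. -/
theorem CheinIn.conj_linear
    (hlin : ∀ φ : FreeMetabelianLie K n ≃ₗ⁅K⁆ FreeMetabelianLie K n,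
      (∀ i, φ (xg K n i) ∈ Submodule.span K (Set.range (xg K n))) → φ ∈ G)
    {i j b : Fin n} (hji : j ≠ i) (hbi : b ≠ i) (hbj : b ≠ j) {α : K} (hα : α ≠ 0) (β : K)
    {m m' : FreeMetabelianLie K n} (h : CheinIn G i m) (hm' : m' ∈ wordSpan (· ≠ i))
    (hmm' : ∀ g : FreeMetabelianLie K n →ₗ⁅K⁆ FreeMetabelianLie K n,
      g (xg K n j) = α • xg K n j + β • xg K n b → (∀ c, c ≠ j → g (xg K n c) = xg K n c) →
      g m = m') :
    CheinIn G i m' := by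
  obtain ⟨g, hgj, hg⟩ := exists_lieAut_single_of_mem_span j hα
    (Submodule.smul_mem _ β (Submodule.subset_span ⟨b, hbj, rfl⟩))
  have e : g m = m' := hmm' g hgj hg
  have hinv : ∀ c, c ≠ j → g⁻¹ (xg K n c) = xg K n c := fun c hc =>
    lieAut_inv_apply_of_eq (hg c hc)
  have hinvj : g⁻¹ (xg K n j) = α⁻¹ • (xg K n j - β • xg K n b) := by
    apply lieAut_inv_apply_of_eq
    rw [map_smul, map_sub, map_smul, hgj, hg b hbj, add_sub_cancel_right, smul_smul,
      inv_mul_cancel₀ hα, one_smul]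
  have hgG : g ∈ G := hlin g fun c => by
    by_cases hc : c = j
    · subst hc
      rw [hgj]
      exact add_mem (Submodule.smul_mem _ _ (Submodule.subset_span ⟨c, rfl⟩))
        (Submodule.smul_mem _ _ (Submodule.subset_span ⟨b, rfl⟩))
    · rw [hg c hc]
      exact Submodule.subset_span ⟨c, rfl⟩
  rw [← e] at hm' ⊢
  refine h.conj hgG (hg i hji.symm) (fun ψ _ hψ c hc => ?_) hm'
  by_cases hcj : c = j
  · subst hcj
    rw [hinvj, map_smul, map_sub, map_smul, hψ c hc, hψ b hbi]
  · rw [hinv c hcj, hψ c hc]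

theorem CheinIn.perm
    (hlin : ∀ φ : FreeMetabelianLie K n ≃ₗ⁅K⁆ FreeMetabelianLie K n,
      (∀ i, φ (xg K n i) ∈ Submodule.span K (Set.range (xg K n))) → φ ∈ G)
    (σ : Equiv.Perm (Fin n)) {i : Fin n} {m m' : FreeMetabelianLie K n} (h : CheinIn G i m)
    (hm' : m' ∈ wordSpan (· ≠ σ i))
    (hmm' : ∀ g : FreeMetabelianLie K n →ₗ⁅K⁆ FreeMetabelianLie K n,
      (∀ c, g (xg K n c) = xg K n (σ c)) → g m = m') :
    CheinIn G (σ i) m' := by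
  obtain ⟨g, hg⟩ := exists_lieAut_perm (K := K) σ
  obtain ⟨-, ψ, hψ, hi, hj⟩ := h
  have e : g m = m' := hmm' g hg
  have hgG : g ∈ G := hlin g fun c => by
    rw [hg c]; exact Submodule.subset_span ⟨_, rfl⟩
  have hinv : ∀ c, g⁻¹ (xg K n c) = xg K n (σ.symm c) := fun c => by
    apply lieAut_inv_apply_of_eq
    rw [hg, σ.apply_symm_apply]
  refine ⟨hm', g * ψ * g⁻¹, mul_mem (mul_mem hgG hψ) (inv_mem hgG), ?_, fun j hji => ?_⟩
  · rw [lieAut_mul_apply, lieAut_mul_apply, hinv, σ.symm_apply_apply, hi, map_add, hg, e]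
  · rw [lieAut_mul_apply, lieAut_mul_apply, hinv,
      hj _ (fun h => hji (by rw [← h, σ.apply_symm_apply])), hg, σ.apply_symm_apply]

/-- The Steinberg relation between `x_a ↦ x_a + m` and `x_i ↦ x_i + [x_a, x_b]`. -/
theorem CheinIn.lie_xg {i a b : Fin n} (hai : a ≠ i) (hba : b ≠ a)
    {m : FreeMetabelianLie K n} (hm : CheinIn G a m) (hmi : m ∈ wordSpan (· ≠ i))
    (hq : CheinIn G i ⁅xg K n a, xg K n b⁆) : CheinIn G i ⁅m, xg K n b⁆ := by
  have hsum : CheinIn G i (⁅xg K n a, xg K n b⁆ + ⁅m, xg K n b⁆) := by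
    obtain ⟨hm', g, hg, hga, hgj⟩ := hm
    have e : g ⁅xg K n a, xg K n b⁆ = ⁅xg K n a, xg K n b⁆ + ⁅m, xg K n b⁆ := by
      rw [LieEquiv.map_lie, hga, hgj b hba, add_lie]
    have hinv : ∀ c, c ≠ a → g⁻¹ (xg K n c) = xg K n c := fun c hc =>
      lieAut_inv_apply_of_eq (hgj c hc)
    have hinva : g⁻¹ (xg K n a) = xg K n a - m := by
      apply lieAut_inv_apply_of_eq
      rw [map_sub, hga, lieAut_apply_eq_self (mem_wordSpan_true hm') hga hgj hm',
        add_sub_cancel_right]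
    rw [← e]
    refine hq.conj hg (hgj i hai.symm) (fun ψ hψ hψj c hc => ?_) ?_
    · by_cases hca : c = a
      · subst hca
        rw [hinva, map_sub, hψ m hmi, hψj c hc]
      · rw [hinv c hca, hψj c hc]
    · rw [e]
      exact add_mem hq.1 (lie_xg_mem_wordSpan hmi b)
  simpa using hsum.sub hq

theorem smul_wordAct_mem_wordSpan {i j k : Fin n} (hj : j ≠ i) (hk : k ≠ i) (l : List (Fin n))
    (t : K) : t • wordAct l ⁅xg K n j, xg K n k⁆ ∈ wordSpan (· ≠ i) :=
  Submodule.smul_mem _ _ (wordAct_mem_wordSpan l hj hk)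

theorem map_wordAct_eq {p : Fin n → Prop}
    (g : FreeMetabelianLie K n →ₗ⁅K⁆ FreeMetabelianLie K n)
    (hg : ∀ c, p c → g (xg K n c) = xg K n c) {l : List (Fin n)} (hl : ∀ c ∈ l, p c)
    (m : FreeMetabelianLie K n) : g (wordAct l m) = wordAct l (g m) := by
  induction l with
  | nil => rfl
  | cons c l ih =>
    rw [wordAct_cons, wordAct_cons, LieHom.map_lie, ih fun d hd => hl d (List.mem_cons_of_mem _ hd),
      hg c (hl c List.mem_cons_self)]

theorem exists_notMem_of_card_lt {n : ℕ} (s : Finset (Fin n)) (h : s.card < n) : ∃ a, a ∉ s := by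
  by_contra! hs
  have := Finset.card_le_card (fun a _ => hs a : (Finset.univ : Finset (Fin n)) ⊆ s)
  simp at this
  omega

/-- All quadratic and all cubic one-row automorphisms lie in `G`. -/
theorem CheinIn.all_of_one
    (hlin : ∀ φ : FreeMetabelianLie K n ≃ₗ⁅K⁆ FreeMetabelianLie K n,
      (∀ i, φ (xg K n i) ∈ Submodule.span K (Set.range (xg K n))) → φ ∈ G)
    {r : ℕ} {i0 i1 i2 : Fin n} (h01 : i1 ≠ i0) (h02 : i2 ≠ i0) (h12 : i1 ≠ i2)
    (h : CheinIn G i0 (wordAct (List.replicate r i0) ⁅xg K n i1, xg K n i2⁆))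
    {i j k : Fin n} (hj : j ≠ i) (hk : k ≠ i) (hjk : j ≠ k) (t : K) :
    CheinIn G i (t • wordAct (List.replicate r i) ⁅xg K n j, xg K n k⁆) := by
  by_cases ht : t = 0
  · rw [ht, zero_smul]
    exact CheinIn.zero i
  obtain ⟨σ, hσ⟩ : ∃ σ : Equiv.Perm (Fin n), σ i0 = i ∧ σ i1 = j ∧ σ i2 = k := by
    have hinj : ∀ {a b c : Fin n}, b ≠ a → c ≠ a → b ≠ c → Function.Injective ![a, b, c] := by
      intro a b c h1 h2 h3 p q hpq
      fin_cases p <;> fin_cases q <;> simp_all [eq_comm]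
    have := Equiv.Perm.isMultiplyPretransitive (Fin n) 3
    obtain ⟨σ, hσ⟩ := MulAction.exists_smul_eq (Equiv.Perm (Fin n))
      (⟨_, hinj h01 h02 h12⟩ : Fin 3 ↪ Fin n) ⟨_, hinj hj hk hjk⟩
    exact ⟨σ, congrArg (fun f => f 0) hσ, congrArg (fun f => f 1) hσ,
      congrArg (fun f => f 2) hσ⟩
  obtain ⟨rfl, rfl, rfl⟩ := hσ
  have h1 : CheinIn G (σ i0) (wordAct (List.replicate r (σ i0)) ⁅xg K n (σ i1), xg K n (σ i2)⁆) := by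
    refine h.perm hlin σ (wordAct_mem_wordSpan _ hj hk) fun g hg => ?_
    clear h
    induction r with
    | zero => simp [hg]
    | succ r ih => simp [List.replicate_succ, hg, ih]
  refine h1.conj_linear hlin hj hk hjk.symm ht 0 (smul_wordAct_mem_wordSpan hj hk _ t)
    fun g hgj hg => ?_
  rw [map_wordAct_eq (p := (· ≠ σ i1)) g hg fun c hc => by
    rw [List.eq_of_mem_replicate hc]; exact hj.symm]
  rw [LieHom.map_lie, hgj, hg _ hjk.symm, zero_smul, add_zero, smul_lie]
  generalize List.replicate r (σ i0) = l
  induction l with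
  | nil => rfl
  | cons c l ih => rw [wordAct_cons, ih, wordAct_cons, smul_lie]

/-- The words containing a letter different from `x_i`, one degree up. -/
theorem CheinIn.cons_of_ne
    (hK : (4 ≤ n ∧ ringChar K ≠ 3) ∨ 5 ≤ n)
    (hlin : ∀ φ : FreeMetabelianLie K n ≃ₗ⁅K⁆ FreeMetabelianLie K n,
      (∀ i, φ (xg K n i) ∈ Submodule.span K (Set.range (xg K n))) → φ ∈ G)
    (hquad : ∀ {i j k : Fin n}, j ≠ i → k ≠ i → j ≠ k → CheinIn G i ⁅xg K n j, xg K n k⁆)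
    {d : ℕ}
    (ih : ∀ {i j k : Fin n}, j ≠ i → k ≠ i → j ≠ k → ∀ (l : List (Fin n)), l.length = d →
      ∀ t : K, CheinIn G i (t • wordAct l ⁅xg K n j, xg K n k⁆))
    {i j k b : Fin n} (hj : j ≠ i) (hk : k ≠ i) (hjk : j ≠ k) (hb : b ≠ i)
    (l : List (Fin n)) (hl : l.length = d) (t : K) :
    CheinIn G i (t • wordAct (b :: l) ⁅xg K n j, xg K n k⁆) := by
  have hstep : ∀ {j k a b : Fin n}, j ≠ i → k ≠ i → j ≠ k → b ≠ i → a ∉ ({i, j, k, b} : Finset _) →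
      ∀ l : List (Fin n), l.length = d → ∀ t : K,
      CheinIn G i (t • wordAct (b :: l) ⁅xg K n j, xg K n k⁆) := by
    intro j k a b hj hk hjk hb ha l hl t
    simp only [Finset.mem_insert, Finset.mem_singleton, not_or] at ha
    obtain ⟨hai, haj, hak, hab⟩ := ha
    rw [wordAct_cons, ← smul_lie]
    exact (ih (Ne.symm haj) (Ne.symm hak) hjk l hl t).lie_xg hai (Ne.symm hab)
      (smul_wordAct_mem_wordSpan hj hk l t) (hquad hai hb hab)
  rcases hK with ⟨hn, hchar⟩ | hn
  swap
  · obtain ⟨a, ha⟩ := exists_notMem_of_card_lt {i, j, k, b} (Finset.card_le_four.trans_lt hn)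
    exact hstep hj hk hjk hb ha l hl t
  have hleft : ∀ {j k : Fin n}, j ≠ i → k ≠ i → j ≠ k → ∀ l : List (Fin n), l.length = d →
      ∀ t : K, CheinIn G i (t • wordAct (j :: l) ⁅xg K n j, xg K n k⁆) := by
    intro j k hj hk hjk l hl t
    obtain ⟨a, ha⟩ := exists_notMem_of_card_lt {i, j, k} (Finset.card_le_three.trans_lt hn)
    refine hstep hj hk hjk hj (a := a) ?_ l hl t
    simp only [Finset.mem_insert, Finset.mem_singleton] at ha ⊢
    tauto
  have hright : ∀ {j k : Fin n}, j ≠ i → k ≠ i → j ≠ k → ∀ l : List (Fin n), l.length = d →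
      ∀ t : K, CheinIn G i (t • wordAct (k :: l) ⁅xg K n j, xg K n k⁆) := by
    intro j k hj hk hjk l hl t
    obtain ⟨a, ha⟩ := exists_notMem_of_card_lt {i, j, k} (Finset.card_le_three.trans_lt hn)
    refine hstep hj hk hjk hk (a := a) ?_ l hl t
    simp only [Finset.mem_insert, Finset.mem_singleton] at ha ⊢
    tauto
  by_cases hbj : b = j
  · subst hbj; exact hleft hj hk hjk l hl t
  by_cases hbk : b = k
  · subst hbk; exact hright hj hk hjk l hl t
  by_cases hjl : j ∈ l
  · have hp : (b :: l).Perm (j :: b :: l.erase j) :=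
      ((List.perm_cons_erase hjl).cons b).trans (List.Perm.swap _ _ _)
    rw [wordAct_perm hp]
    refine hleft hj hk hjk _ ?_ t
    have := (List.perm_cons_erase hjl).length_eq
    simp only [List.length_cons] at this ⊢
    omega
  by_cases hkl : k ∈ l
  · have hp : (b :: l).Perm (k :: b :: l.erase k) :=
      ((List.perm_cons_erase hkl).cons b).trans (List.Perm.swap _ _ _)
    rw [wordAct_perm hp]
    refine hright hj hk hjk _ ?_ t
    have := (List.perm_cons_erase hkl).length_eq
    simp only [List.length_cons] at this ⊢
    omega
  have h3 : (3 : K) ≠ 0 := fun h0 => by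
    have h3' : ((3 : ℕ) : K) = 0 := by exact_mod_cast h0
    rcases (Nat.dvd_prime Nat.prime_three).1 (ringChar.dvd h3') with h | h
    · exact CharP.ringChar_ne_one h
    · exact hchar h
  have key : ∀ s : K, CheinIn G i ((s * 3) • wordAct (b :: l) ⁅xg K n j, xg K n k⁆) := by
    intro s
    have hjl' : ∀ c ∈ l, c ≠ j := fun c hc e => hjl (e ▸ hc)
    have hkl' : ∀ c ∈ l, c ≠ k := fun c hc e => hkl (e ▸ hc)
    have A : CheinIn G i (s • wordAct (j :: l) ⁅xg K n j, xg K n k⁆ +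
        s • wordAct (b :: l) ⁅xg K n j, xg K n k⁆ + s • wordAct (j :: l) ⁅xg K n b, xg K n k⁆ +
        s • wordAct (b :: l) ⁅xg K n b, xg K n k⁆) := by
      refine (hleft hj hk hjk l hl s).conj_linear hlin hj hb hbj one_ne_zero 1 ?_
        fun g hgj hg => ?_
      · exact add_mem (add_mem (add_mem (smul_wordAct_mem_wordSpan hj hk _ s)
          (smul_wordAct_mem_wordSpan hj hk _ s)) (smul_wordAct_mem_wordSpan hb hk _ s))
          (smul_wordAct_mem_wordSpan hb hk _ s)
      · rw [one_smul, one_smul] at hgj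
        rw [map_smul, wordAct_cons, LieHom.map_lie, map_wordAct_eq (p := (· ≠ j)) g hg hjl',
          LieHom.map_lie, hgj, hg k (Ne.symm hjk), add_lie, wordAct_add]
        simp only [wordAct_cons, add_lie, lie_add, smul_add]
        abel
    have B : CheinIn G i (s • wordAct (k :: l) ⁅xg K n j, xg K n k⁆ +
        s • wordAct (b :: l) ⁅xg K n j, xg K n k⁆ + s • wordAct (k :: l) ⁅xg K n j, xg K n b⁆ +
        s • wordAct (b :: l) ⁅xg K n j, xg K n b⁆) := by
      refine (hright hj hk hjk l hl s).conj_linear hlin hk hb hbk one_ne_zero 1 ?_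
        fun g hgk hg => ?_
      · exact add_mem (add_mem (add_mem (smul_wordAct_mem_wordSpan hj hk _ s)
          (smul_wordAct_mem_wordSpan hj hk _ s)) (smul_wordAct_mem_wordSpan hj hb _ s))
          (smul_wordAct_mem_wordSpan hj hb _ s)
      · rw [one_smul, one_smul] at hgk
        rw [map_smul, wordAct_cons, LieHom.map_lie, map_wordAct_eq (p := (· ≠ k)) g hg hkl',
          LieHom.map_lie, hgk, hg j hjk, lie_add (xg K n j), wordAct_add]
        simp only [wordAct_cons, add_lie, lie_add, smul_add]
        abel
    have J : wordAct (j :: l) ⁅xg K n b, xg K n k⁆ + wordAct (k :: l) ⁅xg K n j, xg K n b⁆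
        = wordAct (b :: l) ⁅xg K n j, xg K n k⁆ := by
      have hsnoc : ∀ (c : Fin n) (p q : FreeMetabelianLie K n),
          wordAct (c :: l) ⁅p, q⁆ = wordAct l ⁅⁅p, q⁆, xg K n c⁆ := by
        intro c p q
        have hp : (c :: l).Perm (l ++ [c]) := (List.perm_append_singleton c l).symm
        rw [wordAct_perm hp, wordAct_append, wordAct_cons, wordAct_nil]
      rw [hsnoc, hsnoc, hsnoc, ← wordAct_add]
      congr 1
      have h1 := lie_jacobi (xg K n j) (xg K n k) (xg K n b)
      rw [← lie_skew (xg K n j) ⁅xg K n k, xg K n b⁆, ← lie_skew (xg K n k) ⁅xg K n b, xg K n j⁆,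
        ← lie_skew (xg K n b) ⁅xg K n j, xg K n k⁆,
        ← lie_skew (xg K n k) (xg K n b), ← lie_skew (xg K n b) (xg K n j)] at h1
      simp only [neg_lie, neg_neg] at h1
      rw [eq_comm, ← sub_eq_zero, ← neg_eq_zero, ← h1]
      abel
    have C := (((A.sub (hleft hj hk hjk l hl s)).sub (hleft hb hk hbk l hl s)).add
      ((B.sub (hright hj hk hjk l hl s)).sub (hright hj hb (Ne.symm hbj) l hl s)))
    convert C using 1
    have J' := congrArg (s • ·) J
    simp only [smul_add] at J'
    rw [mul_comm, mul_smul, ← Nat.cast_ofNat (R := K), Nat.cast_smul_eq_nsmul]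
    rw [← sub_eq_zero]
    rw [← sub_eq_zero] at J'
    rw [← neg_eq_zero, ← J']
    abel
  have := key (t * 3⁻¹)
  rwa [mul_assoc, inv_mul_cancel₀ h3, mul_one] at this

theorem CheinIn.word
    (hK : (4 ≤ n ∧ ringChar K ≠ 3) ∨ 5 ≤ n)
    (hlin : ∀ φ : FreeMetabelianLie K n ≃ₗ⁅K⁆ FreeMetabelianLie K n,
      (∀ i, φ (xg K n i) ∈ Submodule.span K (Set.range (xg K n))) → φ ∈ G)
    {i0 i1 i2 : Fin n} (h01 : i1 ≠ i0) (h02 : i2 ≠ i0) (h12 : i1 ≠ i2)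
    (hquad : CheinIn G i0 ⁅xg K n i1, xg K n i2⁆)
    (hcub : CheinIn G i0 ⁅⁅xg K n i1, xg K n i2⁆, xg K n i0⁆)
    {i j k : Fin n} (hj : j ≠ i) (hk : k ≠ i) (hjk : j ≠ k) (l : List (Fin n)) (t : K) :
    CheinIn G i (t • wordAct l ⁅xg K n j, xg K n k⁆) := by
  obtain ⟨d, hl⟩ : ∃ d, l.length = d := ⟨_, rfl⟩
  induction d generalizing i j k l t with
  | zero =>
    rw [List.length_eq_zero_iff.1 hl]
    exact CheinIn.all_of_one (r := 0) hlin h01 h02 h12 hquad hj hk hjk t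
  | succ d ih =>
    have hq : ∀ {i j k : Fin n}, j ≠ i → k ≠ i → j ≠ k → CheinIn G i ⁅xg K n j, xg K n k⁆ :=
      fun hj hk hjk => by
        simpa using CheinIn.all_of_one (r := 0) hlin h01 h02 h12 hquad hj hk hjk 1
    have hne : ∀ {i j k b : Fin n}, j ≠ i → k ≠ i → j ≠ k → b ≠ i → ∀ l : List (Fin n), b ∈ l →
        l.length = d + 1 → ∀ t : K, CheinIn G i (t • wordAct l ⁅xg K n j, xg K n k⁆) := by
      intro i j k b hj hk hjk hb l hbl hl t
      have hp := List.perm_cons_erase hbl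
      rw [wordAct_perm hp]
      refine CheinIn.cons_of_ne hK hlin hq (fun hj hk hjk l hl t => ih hj hk hjk l t hl)
        hj hk hjk hb _ ?_ t
      have := hp.length_eq
      simp only [List.length_cons] at this
      omega
    by_cases hbl : ∃ b ∈ l, b ≠ i
    · obtain ⟨b, hbl, hb⟩ := hbl
      exact hne hj hk hjk hb l hbl hl t
    push Not at hbl
    obtain rfl : l = List.replicate (d + 1) i := List.eq_replicate_iff.2 ⟨hl, hbl⟩
    cases d with
    | zero => exact CheinIn.all_of_one (r := 1) hlin h01 h02 h12 hcub hj hk hjk t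
    | succ d =>
      obtain ⟨a, ha⟩ := exists_notMem_of_card_lt {i, j, k}
        (Finset.card_le_three.trans_lt (by omega : 3 < n))
      simp only [Finset.mem_insert, Finset.mem_singleton, not_or] at ha
      obtain ⟨hai, haj, hak⟩ := ha
      set w := t • wordAct (a :: List.replicate (d + 1) i) ⁅xg K n j, xg K n k⁆ with hw
      have hwi : CheinIn G i w := hne hj hk hjk hai _ List.mem_cons_self (by simp) t
      have hwa : CheinIn G a w := hne (Ne.symm haj) (Ne.symm hak) hjk (Ne.symm hai) _
        (List.mem_cons_of_mem _ (List.mem_replicate.2 ⟨by simp, rfl⟩)) (by simp) t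
      have hsum : CheinIn G i
          (w + t • wordAct (List.replicate (d + 1 + 1) i) ⁅xg K n j, xg K n k⁆) := by
        obtain ⟨hwi', ψ, hψ, hψi, hψj⟩ := hwi
        obtain ⟨hwa', χ, hχ, hχa, hχj⟩ := hwa
        obtain ⟨g, hga, hgj⟩ := exists_lieAut_single_of_mem_span (K := K) a one_ne_zero
          (Submodule.subset_span ⟨i, Ne.symm hai, rfl⟩)
        rw [one_smul] at hga
        have hgG : g ∈ G := hlin g fun c => by
          by_cases hc : c = a
          · subst hc
            rw [hga]
            exact add_mem (Submodule.subset_span ⟨c, rfl⟩) (Submodule.subset_span ⟨i, rfl⟩)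
          · rw [hgj c hc]
            exact Submodule.subset_span ⟨c, rfl⟩
        have hginv : ∀ c, c ≠ a → g⁻¹ (xg K n c) = xg K n c := fun c hc =>
          lieAut_inv_apply_of_eq (hgj c hc)
        have hginva : g⁻¹ (xg K n a) = xg K n a - xg K n i := by
          apply lieAut_inv_apply_of_eq
          rw [map_sub, hga, hgj i (Ne.symm hai), add_sub_cancel_right]
        have hgw : g w = w + t • wordAct (List.replicate (d + 1 + 1) i) ⁅xg K n j, xg K n k⁆ := by
          have := map_wordAct_eq (p := (· ≠ a))
            (g : FreeMetabelianLie K n →ₗ⁅K⁆ FreeMetabelianLie K n) hgj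
            (l := List.replicate (d + 1) i)
            (fun c hc => by rw [List.eq_of_mem_replicate hc]; exact Ne.symm hai)
            ⁅xg K n j, xg K n k⁆
          simp only [LieEquiv.coe_toLieHom, LieEquiv.map_lie, hgj j (Ne.symm haj),
            hgj k (Ne.symm hak)] at this
          rw [hw, map_smul, wordAct_cons, LieEquiv.map_lie, this, hga, lie_add, smul_add,
            List.replicate_succ (n := d + 1), wordAct_cons]
        have hψw : ψ w = w := lieAut_apply_eq_self (mem_wordSpan_true hwi') hψi hψj hwi'
        refine ⟨add_mem hwi' (smul_wordAct_mem_wordSpan hj hk _ t), g * (ψ * χ) * g⁻¹,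
          mul_mem (mul_mem hgG (mul_mem hψ hχ)) (inv_mem hgG), ?_, fun c hc => ?_⟩
        · rw [lieAut_mul_apply, lieAut_mul_apply, lieAut_mul_apply, hginv i (Ne.symm hai),
            hχj i (Ne.symm hai), hψi, map_add, hgj i (Ne.symm hai), hgw]
        · rw [lieAut_mul_apply, lieAut_mul_apply, lieAut_mul_apply]
          by_cases hca : c = a
          · subst hca
            rw [hginva, map_sub, hχa, hχj i hc.symm, map_sub, map_add, hψi, hψj c hc, hψw,
              add_sub_add_right_eq_sub, map_sub, hga, hgj i hc.symm, add_sub_cancel_right]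
          · rw [hginv c hca, hχj c hca, hψj c hc, hgj c hca]
      simpa using hsum.sub hwi

theorem CheinIn.of_mem_wordSpan
    (hK : (4 ≤ n ∧ ringChar K ≠ 3) ∨ 5 ≤ n)
    (hlin : ∀ φ : FreeMetabelianLie K n ≃ₗ⁅K⁆ FreeMetabelianLie K n,
      (∀ i, φ (xg K n i) ∈ Submodule.span K (Set.range (xg K n))) → φ ∈ G)
    {i0 i1 i2 : Fin n} (h01 : i1 ≠ i0) (h02 : i2 ≠ i0) (h12 : i1 ≠ i2)
    (hquad : CheinIn G i0 ⁅xg K n i1, xg K n i2⁆)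
    (hcub : CheinIn G i0 ⁅⁅xg K n i1, xg K n i2⁆, xg K n i0⁆)
    {i : Fin n} {m : FreeMetabelianLie K n} (hm : m ∈ wordSpan (· ≠ i)) : CheinIn G i m := by
  suffices h : ∀ t : K, CheinIn G i (t • m) by simpa using h 1
  induction hm using Submodule.span_induction with
  | mem z hz =>
    obtain ⟨j, k, l, hj, hk, rfl⟩ := hz
    intro t
    by_cases hjk : j = k
    · subst hjk
      have h0 : wordAct l (0 : FreeMetabelianLie K n) = 0 := by
        induction l with
        | nil => rfl
        | cons c l ih => rw [wordAct_cons, ih, zero_lie]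
      rw [lie_self, h0, smul_zero]
      exact CheinIn.zero i
    · exact CheinIn.word hK hlin h01 h02 h12 hquad hcub hj hk hjk l t
  | zero => intro t; rw [smul_zero]; exact CheinIn.zero i
  | add a b _ _ ha hb => intro t; rw [smul_add]; exact (ha t).add (hb t)
  | smul s a _ ha => intro t; rw [smul_smul]; exact ha _

/-- The metabelian Lie algebra of pairs of polynomials with `⁅(f, p), (g, q)⁆ = (f q - g p, 0)`,
which records one partial Fox derivative together with the linear part. -/
def FoxModel (K : Type) [Field K] (n : ℕ) : Type :=
  MvPolynomial (Fin n) K × MvPolynomial (Fin n) K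

noncomputable instance : AddCommGroup (FoxModel K n) :=
  inferInstanceAs (AddCommGroup (MvPolynomial (Fin n) K × MvPolynomial (Fin n) K))

noncomputable instance : Module K (FoxModel K n) :=
  inferInstanceAs (Module K (MvPolynomial (Fin n) K × MvPolynomial (Fin n) K))

/-- The pair `(f, p)` as an element of the model. -/
def FoxModel.mk (f p : MvPolynomial (Fin n) K) : FoxModel K n := (f, p)

@[simp] theorem FoxModel.mk_fst (f p : MvPolynomial (Fin n) K) : (FoxModel.mk f p).1 = f := rfl
@[simp] theorem FoxModel.mk_snd (f p : MvPolynomial (Fin n) K) : (FoxModel.mk f p).2 = p := rfl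

theorem FoxModel.ext {a b : FoxModel K n} (h1 : a.1 = b.1) (h2 : a.2 = b.2) : a = b :=
  Prod.ext h1 h2

@[simp] theorem FoxModel.add_fst (a b : FoxModel K n) : (a + b).1 = a.1 + b.1 := rfl
@[simp] theorem FoxModel.add_snd (a b : FoxModel K n) : (a + b).2 = a.2 + b.2 := rfl
@[simp] theorem FoxModel.zero_fst : (0 : FoxModel K n).1 = 0 := rfl
@[simp] theorem FoxModel.zero_snd : (0 : FoxModel K n).2 = 0 := rfl
@[simp] theorem FoxModel.smul_fst (t : K) (a : FoxModel K n) : (t • a).1 = t • a.1 := rfl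
@[simp] theorem FoxModel.smul_snd (t : K) (a : FoxModel K n) : (t • a).2 = t • a.2 := rfl

noncomputable instance : Bracket (FoxModel K n) (FoxModel K n) :=
  ⟨fun a b => FoxModel.mk (a.1 * b.2 - b.1 * a.2) 0⟩

@[simp] theorem FoxModel.lie_fst (a b : FoxModel K n) : ⁅a, b⁆.1 = a.1 * b.2 - b.1 * a.2 := rfl
@[simp] theorem FoxModel.lie_snd (a b : FoxModel K n) : ⁅a, b⁆.2 = 0 := rfl

noncomputable instance : LieRing (FoxModel K n) where
  add_lie a b c := FoxModel.ext (by simp; ring) (by simp)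
  lie_add a b c := FoxModel.ext (by simp; ring) (by simp)
  lie_self a := FoxModel.ext (by simp) (by simp)
  leibniz_lie a b c := FoxModel.ext (by simp; ring) (by simp)

noncomputable instance : LieAlgebra K (FoxModel K n) where
  lie_smul t a b := FoxModel.ext (by simp [smul_sub]) (by simp)

theorem FoxModel.lie_lie_lie_lie (a b c d : FoxModel K n) : ⁅⁅a, b⁆, ⁅c, d⁆⁆ = 0 :=
  FoxModel.ext (by rw [FoxModel.lie_fst, FoxModel.lie_snd, FoxModel.lie_snd]; simp) rfl

/-- Multiplication of the first component by a polynomial. -/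
noncomputable def FoxModel.scale (c : MvPolynomial (Fin n) K) :
    FoxModel K n →ₗ⁅K⁆ FoxModel K n where
  toFun a := FoxModel.mk (c * a.1) a.2
  map_add' a b := FoxModel.ext (mul_add c a.1 b.1) rfl
  map_smul' t a := FoxModel.ext (mul_smul_comm t c a.1) rfl
  map_lie' {a b} := FoxModel.ext
    (show c * (a.1 * b.2 - b.1 * a.2) = c * a.1 * b.2 - c * b.1 * a.2 by ring) rfl

theorem FoxModel.scale_apply (c : MvPolynomial (Fin n) K) (a : FoxModel K n) :
    FoxModel.scale c a = FoxModel.mk (c * a.1) a.2 := rfl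

/-- The `i`-th Fox derivative, paired with the linear part. -/
theorem exists_fox (i : Fin n) : ∃ θ : FreeMetabelianLie K n →ₗ⁅K⁆ FoxModel K n,
    ∀ j, θ (xg K n j) = FoxModel.mk (if j = i then 1 else 0) (MvPolynomial.X j) :=
  exists_lieHom_xg (K := K) FoxModel.lie_lie_lie_lie _

theorem fox_wordAct {i : Fin n} {θ : FreeMetabelianLie K n →ₗ⁅K⁆ FoxModel K n}
    (hθ : ∀ j, θ (xg K n j) = FoxModel.mk (if j = i then 1 else 0) (MvPolynomial.X j))
    (l : List (Fin n)) (j k : Fin n) :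
    θ (wordAct l ⁅xg K n j, xg K n k⁆) =
      FoxModel.mk (((if j = i then 1 else 0) * MvPolynomial.X k -
        (if k = i then 1 else 0) * MvPolynomial.X j) * (l.map MvPolynomial.X).prod) 0 := by
  induction l with
  | nil => rw [wordAct_nil, LieHom.map_lie, hθ, hθ]; exact FoxModel.ext (by simp) rfl
  | cons c l ih =>
    rw [wordAct_cons, LieHom.map_lie, ih, hθ]
    refine FoxModel.ext ?_ rfl
    simp only [FoxModel.lie_fst, FoxModel.mk_fst, FoxModel.mk_snd, List.map_cons, List.prod_cons]
    ring

theorem wordAct_sub_mem_wordSpan {i k k' : Fin n} (hk : k ≠ i) (hk' : k' ≠ i)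
    {l l' : List (Fin n)} (h : (k :: l).Perm (k' :: l')) :
    wordAct l ⁅xg K n i, xg K n k⁆ - wordAct l' ⁅xg K n i, xg K n k'⁆ ∈
      wordSpan (K := K) (· ≠ i) := by
  by_cases hkk : k = k'
  · subst hkk
    rw [wordAct_perm h.cons_inv, sub_self]
    exact zero_mem _
  · have hmem : k' ∈ l := by
      have : k' ∈ k :: l := h.mem_iff.2 List.mem_cons_self
      exact (List.mem_cons.1 this).resolve_left (Ne.symm hkk)
    have hl : l.Perm (k' :: l.erase k') := List.perm_cons_erase hmem
    have hl' : l'.Perm (k :: l.erase k') := by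
      refine List.Perm.cons_inv (a := k') (h.symm.trans ?_)
      exact (hl.cons k).trans (List.Perm.swap _ _ _)
    have e1 := wordAct_perm (hl.trans (List.perm_append_singleton k' _).symm)
      (xg K n i) (xg K n k)
    have e2 := wordAct_perm (hl'.trans (List.perm_append_singleton k _).symm)
      (xg K n i) (xg K n k')
    have e3 : ⁅⁅xg K n i, xg K n k⁆, xg K n k'⁆ =
        ⁅⁅xg K n i, xg K n k'⁆, xg K n k⁆ + -⁅⁅xg K n k, xg K n k'⁆, xg K n i⁆ := by
      rw [lie_lie, ← lie_skew ⁅xg K n k, xg K n k'⁆, ← lie_skew ⁅xg K n i, xg K n k'⁆]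
      abel
    rw [e1, e2, wordAct_append, wordAct_append, wordAct_cons, wordAct_cons, wordAct_nil,
      wordAct_nil, e3, wordAct_add, add_sub_cancel_left]
    exact wordAct_mem (neg_mem
      (lie_xg_mem_wordSpan (wordAct_mem_wordSpan (p := (· ≠ i)) [] hk hk') i)) _

theorem prod_map_X_eq_monomial (l : List (Fin n)) :
    (l.map MvPolynomial.X).prod =
      MvPolynomial.monomial (Multiset.toFinsupp (l : Multiset (Fin n))) (1 : K) := by
  induction l with
  | nil => simp
  | cons c l ih =>
    rw [List.map_cons, List.prod_cons, ih, ← Multiset.cons_coe, ← Multiset.singleton_add,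
      map_add, Multiset.toFinsupp_singleton, MvPolynomial.X, MvPolynomial.monomial_mul, one_mul]

/-- An element of the derived ideal with vanishing `i`-th Fox derivative does not involve `x_i` in
the inner bracket of its words. -/
theorem mem_wordSpan_of_fox_eq_zero {i : Fin n} {θ : FreeMetabelianLie K n →ₗ⁅K⁆ FoxModel K n}
    (hθ : ∀ j, θ (xg K n j) = FoxModel.mk (if j = i then 1 else 0) (MvPolynomial.X j))
    {m : FreeMetabelianLie K n} (hm : m ∈ wordSpan fun _ => True) (h0 : (θ m).1 = 0) :
    m ∈ wordSpan (K := K) (· ≠ i) := by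
  classical
  let N : Submodule K (FreeMetabelianLie K n) := wordSpan (· ≠ i)
  let W : (Fin n →₀ ℕ) → FreeMetabelianLie K n ⧸ N := fun t =>
    if h : ∃ p : Fin n × List (Fin n), p.1 ≠ i ∧
        Multiset.toFinsupp ((p.1 :: p.2 : List (Fin n)) : Multiset (Fin n)) = t then
      N.mkQ (wordAct h.choose.2 ⁅xg K n i, xg K n h.choose.1⁆)
    else 0
  let R : MvPolynomial (Fin n) K →ₗ[K] FreeMetabelianLie K n ⧸ N :=
    (MvPolynomial.basisMonomials (Fin n) K).constr K W
  have hR : ∀ (k : Fin n) (l : List (Fin n)), k ≠ i →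
      R (MvPolynomial.X k * (l.map MvPolynomial.X).prod) =
        N.mkQ (wordAct l ⁅xg K n i, xg K n k⁆) := by
    intro k l hk
    have e : (MvPolynomial.X k * (l.map MvPolynomial.X).prod : MvPolynomial (Fin n) K) =
        MvPolynomial.basisMonomials (Fin n) K
          (Multiset.toFinsupp ((k :: l : List (Fin n)) : Multiset (Fin n))) := by
      rw [MvPolynomial.coe_basisMonomials]
      have := prod_map_X_eq_monomial (K := K) (k :: l)
      rwa [List.map_cons, List.prod_cons] at this
    have h : ∃ p : Fin n × List (Fin n), p.1 ≠ i ∧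
        Multiset.toFinsupp ((p.1 :: p.2 : List (Fin n)) : Multiset (Fin n)) =
        Multiset.toFinsupp ((k :: l : List (Fin n)) : Multiset (Fin n)) := ⟨(k, l), hk, rfl⟩
    rw [e, Module.Basis.constr_basis]
    simp only [W]
    rw [dif_pos h, ← sub_eq_zero, ← map_sub, Submodule.mkQ_apply, Submodule.Quotient.mk_eq_zero]
    exact wordAct_sub_mem_wordSpan h.choose_spec.1 hk
      (Multiset.coe_eq_coe.1 (Multiset.toFinsupp.injective h.choose_spec.2))
  have key : N.mkQ m = R (θ m).1 := by
    clear h0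
    induction hm using Submodule.span_induction with
    | mem z hz =>
      obtain ⟨j, k, l, -, -, rfl⟩ := hz
      rw [fox_wordAct hθ]
      by_cases hj : j = i <;> by_cases hk : k = i
      · subst hj
        subst hk
        have : wordAct l ⁅xg K n k, xg K n k⁆ = 0 := by
          have := wordAct_mem (p := fun _ => False) (zero_mem (wordSpan (K := K) _)) l
          rw [lie_self]
          simpa [wordSpan] using this
        rw [this]
        simp
      · subst hj
        simp [hk, hR k l hk]
      · subst hk
        have : wordAct l ⁅xg K n j, xg K n k⁆ = -wordAct l ⁅xg K n k, xg K n j⁆ := by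
          rw [← wordAct_neg, lie_skew]
        rw [this, map_neg, ← hR j l hj]
        simp [hj]
      · have : N.mkQ (wordAct l ⁅xg K n j, xg K n k⁆) = 0 := by
          rw [Submodule.mkQ_apply, Submodule.Quotient.mk_eq_zero]
          exact wordAct_mem_wordSpan l hj hk
        rw [this]
        simp [hj, hk]
    | zero => simp
    | add a b _ _ ha hb => rw [map_add, map_add, FoxModel.add_fst, map_add, ha, hb]
    | smul t a _ ha => rw [map_smul, map_smul, FoxModel.smul_fst, map_smul, ha]
  rw [h0, map_zero, Submodule.mkQ_apply, Submodule.Quotient.mk_eq_zero] at key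
  exact key

theorem constantCoeff_fox {i : Fin n} {θ : FreeMetabelianLie K n →ₗ⁅K⁆ FoxModel K n}
    (hθ : ∀ j, θ (xg K n j) = FoxModel.mk (if j = i then 1 else 0) (MvPolynomial.X j))
    {m : FreeMetabelianLie K n} (hm : m ∈ wordSpan fun _ => True) :
    MvPolynomial.constantCoeff (θ m).1 = 0 ∧ (θ m).2 = 0 := by
  induction hm using Submodule.span_induction with
  | mem z hz =>
    obtain ⟨j, k, l, -, -, rfl⟩ := hz
    rw [fox_wordAct hθ]
    refine ⟨?_, rfl⟩
    rw [FoxModel.mk_fst, map_mul, map_sub, map_mul, map_mul, MvPolynomial.constantCoeff_X,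
      MvPolynomial.constantCoeff_X, mul_zero, mul_zero, sub_zero, zero_mul]
  | zero => simp
  | add a b _ _ ha hb => simp [ha.1, hb.1, ha.2, hb.2]
  | smul t a _ ha => simp [ha.1, ha.2]

/-- A Chein automorphism which is the identity modulo the derived ideal. -/
theorem mem_wordSpan_of_chein {i : Fin n} {m : FreeMetabelianLie K n}
    {ψ : FreeMetabelianLie K n ≃ₗ⁅K⁆ FreeMetabelianLie K n}
    (hm : m ∈ wordSpan fun _ => True) (hi : ψ (xg K n i) = xg K n i + m)
    (hj : ∀ j, j ≠ i → ψ (xg K n j) = xg K n j) : m ∈ wordSpan (K := K) (· ≠ i) := by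
  obtain ⟨θ, hθ⟩ := exists_fox (K := K) i
  have hscale : ∀ (χ : FreeMetabelianLie K n ≃ₗ⁅K⁆ FreeMetabelianLie K n)
      (u : FreeMetabelianLie K n), u ∈ (wordSpan fun _ => True) →
      χ (xg K n i) = xg K n i + u → (∀ j, j ≠ i → χ (xg K n j) = xg K n j) →
      ∀ z, θ (χ z) = FoxModel.scale (1 + (θ u).1) (θ z) := by
    intro χ u hu hχi hχj z
    have : θ.comp (χ : FreeMetabelianLie K n →ₗ⁅K⁆ FreeMetabelianLie K n) =
        (FoxModel.scale (1 + (θ u).1)).comp θ := by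
      refine lieHom_ext_xg fun j => ?_
      rw [LieHom.comp_apply, LieHom.comp_apply, LieEquiv.coe_toLieHom, FoxModel.scale_apply]
      by_cases h : j = i
      · subst h
        rw [hχi, map_add]
        exact FoxModel.ext (by simp [hθ]) (by simp [hθ, (constantCoeff_fox hθ hu).2])
      · rw [hχj j h, hθ]
        simp [h]
    exact LieHom.congr_fun this z
  set u := ψ⁻¹ m with hu
  have hum : u ∈ wordSpan (K := K) fun _ : Fin n => True :=
    map_mem_wordSpan (ψ⁻¹ : FreeMetabelianLie K n ≃ₗ⁅K⁆ FreeMetabelianLie K n).toLieHom hm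
  have hi' : ψ⁻¹ (xg K n i) = xg K n i + -u := by
    have := congrArg (fun z => (ψ⁻¹ : FreeMetabelianLie K n ≃ₗ⁅K⁆ FreeMetabelianLie K n) z) hi
    rw [lieAut_inv_apply_self, map_add, ← hu] at this
    exact eq_add_neg_of_add_eq this.symm
  have h1 := hscale ψ m hm hi hj (ψ⁻¹ (xg K n i))
  rw [hscale ψ⁻¹ (-u) (neg_mem hum) hi' (fun j h => lieAut_inv_apply_of_eq (hj j h)),
    lieAut_apply_inv_self] at h1
  have h2 : (1 : MvPolynomial (Fin n) K) = (1 + (θ m).1) * (1 + (θ (-u)).1) := by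
    have := congrArg Prod.fst h1
    simpa [FoxModel.scale_apply, hθ] using this
  have h3 : IsUnit (1 + (θ m).1) := IsUnit.of_mul_eq_one _ h2.symm
  obtain ⟨c, -, hc⟩ := MvPolynomial.isUnit_iff_eq_C_of_isReduced.1 h3
  refine mem_wordSpan_of_fox_eq_zero hθ hm ?_
  have h4 := congrArg MvPolynomial.constantCoeff hc
  rw [map_add, map_one, (constantCoeff_fox hθ hm).1, add_zero,
    MvPolynomial.constantCoeff_C] at h4
  rw [← h4, MvPolynomial.C_1] at hc
  exact add_eq_left.1 hc

/-- The abelianization. -/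
theorem exists_abelianization (K : Type) [Field K] (n : ℕ) :
    ∃ π : FreeMetabelianLie K n →ₗ[K] (Fin n → K),
      (∀ i, π (xg K n i) = Pi.single i 1) ∧ ∀ m ∈ wordSpan fun _ => True, π m = 0 := by
  let _ : LieRing (Fin n → K) := LieRing.ofAssociativeRing
  have hab : ∀ a b : Fin n → K, ⁅a, b⁆ = 0 := fun a b => by
    rw [LieRing.of_associative_ring_bracket, mul_comm, sub_self]
  obtain ⟨π, hπ⟩ := exists_lieHom_xg (K := K) (L := Fin n → K) (n := n)
    (fun a b c d => hab _ _) (fun i => Pi.single i 1)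
  refine ⟨π, hπ, fun m hm => ?_⟩
  change π m = 0
  induction hm using Submodule.span_induction with
  | mem z hz =>
    obtain ⟨j, k, l, -, -, rfl⟩ := hz
    obtain ⟨c, d, h⟩ := wordAct_lie_eq_lie l (xg K n j) (xg K n k)
    rw [h, LieHom.map_lie, hab]
  | zero => exact map_zero π
  | add a b _ _ ha hb => rw [map_add, ha, hb, add_zero]
  | smul t a _ ha => rw [map_smul, ha, smul_zero]

theorem exists_eq_sum_map_xg (φ : FreeMetabelianLie K n ≃ₗ⁅K⁆ FreeMetabelianLie K n)
    {π : FreeMetabelianLie K n →ₗ[K] (Fin n → K)} (hπ : ∀ i, π (xg K n i) = Pi.single i 1)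
    (hπ0 : ∀ m ∈ wordSpan fun _ => True, π m = 0) (w : Fin n → K) :
    ∃ c : Fin n → K, w = ∑ j, c j • π (φ (xg K n j)) := by
  obtain ⟨a, ha, s, hs, h⟩ := exists_linear_add_word (φ⁻¹ (∑ j, w j • xg K n j))
  obtain ⟨c, rfl⟩ := (Submodule.mem_span_range_iff_exists_fun K).1 ha
  refine ⟨c, ?_⟩
  have h1 := congrArg (fun z => π (φ z)) h
  simp only [lieAut_apply_inv_self, map_add, map_sum, map_smul, hπ] at h1
  rw [show π (φ s) = 0 from hπ0 _ (map_mem_wordSpan φ.toLieHom hs), add_zero] at h1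
  rw [← h1]
  ext i
  simp [Finset.sum_apply, Pi.single_apply]

/-- Chein automorphisms lie in every subgroup containing the linear, the basic quadratic and the
basic cubic automorphism. -/
theorem IsCheinAut.mem_of_quadratic_cubic
    (hK : (4 ≤ n ∧ ringChar K ≠ 3) ∨ 5 ≤ n)
    (hlin : ∀ φ : FreeMetabelianLie K n ≃ₗ⁅K⁆ FreeMetabelianLie K n,
      (∀ i, φ (xg K n i) ∈ Submodule.span K (Set.range (xg K n))) → φ ∈ G)
    {i0 i1 i2 : Fin n} (h01 : i1 ≠ i0) (h02 : i2 ≠ i0) (h12 : i1 ≠ i2)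
    (hquad : CheinIn G i0 ⁅xg K n i1, xg K n i2⁆)
    (hcub : CheinIn G i0 ⁅⁅xg K n i1, xg K n i2⁆, xg K n i0⁆)
    {φ : FreeMetabelianLie K n ≃ₗ⁅K⁆ FreeMetabelianLie K n} (hφ : IsCheinAut K n φ) : φ ∈ G := by
  obtain ⟨i, hφ⟩ := hφ
  obtain ⟨a, ha, s, hs, h⟩ := exists_linear_add_word (φ (xg K n i))
  obtain ⟨c, rfl⟩ := (Submodule.mem_span_range_iff_exists_fun K).1 ha
  have hα : c i ≠ 0 := by
    intro hc
    obtain ⟨π, hπ, hπ0⟩ := exists_abelianization K n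
    obtain ⟨d, hd⟩ := exists_eq_sum_map_xg φ hπ hπ0 (Pi.single i 1)
    have h1 := congrFun hd i
    rw [Pi.single_eq_same, Finset.sum_apply, Finset.sum_eq_zero] at h1
    · exact one_ne_zero h1
    · intro j _
      by_cases hj : j = i
      · subst hj
        rw [h, map_add, hπ0 s hs, add_zero, map_sum]
        simp only [map_smul, hπ, Pi.smul_apply, Finset.sum_apply]
        simp [Pi.single_apply, hc]
      · rw [hφ j hj, hπ]
        simp [Ne.symm hj]
  have hs' : ∑ j ∈ Finset.univ.erase i, c j • xg K n j ∈
      Submodule.span K (xg K n '' {b | b ≠ i}) :=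
    Submodule.sum_mem _ fun j hj => Submodule.smul_mem _ _
      (Submodule.subset_span ⟨j, Finset.ne_of_mem_erase hj, rfl⟩)
  obtain ⟨g, hgi, hgj⟩ := exists_lieAut_single_of_mem_span i hα hs'
  rw [Finset.add_sum_erase _ (fun j => c j • xg K n j) (Finset.mem_univ i)] at hgi
  have hg : g ∈ G := by
    refine hlin g fun j => ?_
    by_cases hj : j = i
    · subst hj
      rw [hgi]
      exact ha
    · rw [hgj j hj]
      exact Submodule.subset_span ⟨j, rfl⟩
  have hψi : (g⁻¹ * φ) (xg K n i) = xg K n i + g⁻¹ s := by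
    rw [lieAut_mul_apply, h, map_add, lieAut_inv_apply_of_eq hgi]
  have hψj : ∀ j, j ≠ i → (g⁻¹ * φ) (xg K n j) = xg K n j := fun j hj => by
    rw [lieAut_mul_apply, hφ j hj, lieAut_inv_apply_of_eq (hgj j hj)]
  have hm := mem_wordSpan_of_chein (map_mem_wordSpan
    (g⁻¹ : FreeMetabelianLie K n ≃ₗ⁅K⁆ FreeMetabelianLie K n).toLieHom hs) hψi hψj
  obtain ⟨-, ψ, hψ, hi, hj⟩ := CheinIn.of_mem_wordSpan hK hlin h01 h02 h12 hquad hcub hm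
  have e : g⁻¹ * φ = ψ := lieAut_ext_xg fun j => by
    by_cases h : j = i
    · subst h
      rw [hψi, hi]
      rfl
    · rw [hψj j h, hj j h]
  rw [← inv_mul_cancel_left g⁻¹ φ, inv_inv, e]
  exact mul_mem hg hψ

/-- A linear automorphism with the given matrix which is a product of Chein automorphisms. -/
def IsCheinMatrix (A : Matrix (Fin n) (Fin n) K) : Prop :=
  ∃ φ ∈ Subgroup.closure {φ : FreeMetabelianLie K n ≃ₗ⁅K⁆ FreeMetabelianLie K n |
    IsCheinAut K n φ}, ∀ k, φ (xg K n k) = ∑ l, A l k • xg K n l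

theorem IsCheinMatrix.mul {A B : Matrix (Fin n) (Fin n) K} (hA : IsCheinMatrix A)
    (hB : IsCheinMatrix B) : IsCheinMatrix (A * B) := by
  obtain ⟨φ, hφ, hA⟩ := hA
  obtain ⟨ψ, hψ, hB⟩ := hB
  refine ⟨φ * ψ, mul_mem hφ hψ, fun k => ?_⟩
  rw [lieAut_mul_apply, hB, map_sum]
  simp only [map_smul, hA, Finset.smul_sum, smul_smul, Matrix.mul_apply, Finset.sum_smul]
  rw [Finset.sum_comm]
  simp only [mul_comm]

theorem isCheinMatrix_diagonal (D : Fin n → K) (hD : ∀ i, D i ≠ 0) :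
    IsCheinMatrix (Matrix.diagonal D) := by
  classical
  suffices h : ∀ S : Finset (Fin n), ∃ φ ∈ Subgroup.closure
      {φ : FreeMetabelianLie K n ≃ₗ⁅K⁆ FreeMetabelianLie K n | IsCheinAut K n φ},
      ∀ k, φ (xg K n k) = (if k ∈ S then D k else 1) • xg K n k by
    obtain ⟨φ, hφ, h⟩ := h Finset.univ
    refine ⟨φ, hφ, fun k => ?_⟩
    rw [h, Finset.sum_eq_single k (fun l _ hl => by rw [Matrix.diagonal_apply_ne _ hl, zero_smul])
      (fun hk => absurd (Finset.mem_univ k) hk), Matrix.diagonal_apply_eq,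
      if_pos (Finset.mem_univ k)]
  intro S
  induction S using Finset.induction_on with
  | empty => exact ⟨1, one_mem _, fun k => by simp⟩
  | insert i S hi ih =>
    obtain ⟨φ, hφ, h⟩ := ih
    obtain ⟨g, hgi, hgj⟩ := exists_lieAut_single_of_mem_span i (hD i)
      (zero_mem (Submodule.span K (xg K n '' {b | b ≠ i})))
    refine ⟨φ * g, mul_mem hφ (Subgroup.subset_closure ⟨i, hgj⟩), fun k => ?_⟩
    rw [lieAut_mul_apply]
    by_cases hk : k = i
    · subst hk
      rw [hgi, add_zero, map_smul, h, if_neg hi, one_smul, if_pos (Finset.mem_insert_self k S)]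
    · rw [hgj k hk, h]
      simp [hk]

theorem isCheinMatrix_transvection {i j : Fin n} (hij : i ≠ j) (c : K) :
    IsCheinMatrix (Matrix.transvection i j c) := by
  obtain ⟨g, hgi, hgj⟩ := exists_lieAut_single_of_mem_span j one_ne_zero
    (Submodule.smul_mem _ c (Submodule.subset_span (R := K) (s := xg K n '' {b | b ≠ j})
      ⟨i, hij, rfl⟩))
  refine ⟨g, Subgroup.subset_closure ⟨j, hgj⟩, fun k => ?_⟩
  simp only [Matrix.transvection, Matrix.add_apply, add_smul, Finset.sum_add_distrib,
    Matrix.one_apply, Matrix.single_apply, ite_smul, one_smul, zero_smul, Finset.sum_ite_eq',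
    Finset.mem_univ, if_true]
  by_cases hk : k = j
  · subst hk
    simp [hgi]
  · simp [hgj k hk, Ne.symm hk]

theorem isCheinMatrix_of_det_ne_zero {A : Matrix (Fin n) (Fin n) K} (hA : A.det ≠ 0) :
    IsCheinMatrix A := by
  refine Matrix.diagonal_transvection_induction_of_det_ne_zero _ A hA (fun D hD => ?_)
    (fun t => isCheinMatrix_transvection t.hij t.c) (fun A B _ _ hA hB => hA.mul hB)
  rw [Matrix.det_diagonal] at hD
  exact isCheinMatrix_diagonal D fun i => Finset.prod_ne_zero_iff.1 hD i (Finset.mem_univ i)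

theorem mem_closure_chein_of_linear {φ : FreeMetabelianLie K n ≃ₗ⁅K⁆ FreeMetabelianLie K n}
    (hφ : ∀ i, φ (xg K n i) ∈ Submodule.span K (Set.range (xg K n))) :
    φ ∈ Subgroup.closure {φ : FreeMetabelianLie K n ≃ₗ⁅K⁆ FreeMetabelianLie K n |
      IsCheinAut K n φ} := by
  choose a ha using fun i => (Submodule.mem_span_range_iff_exists_fun K).1 (hφ i)
  let A : Matrix (Fin n) (Fin n) K := Matrix.of fun l k => a k l
  have hA : IsUnit A := by
    rw [← Matrix.mulVec_surjective_iff_isUnit]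
    intro w
    obtain ⟨π, hπ, hπ0⟩ := exists_abelianization K n
    obtain ⟨c, hc⟩ := exists_eq_sum_map_xg φ hπ hπ0 w
    refine ⟨c, ?_⟩
    rw [hc]
    ext i
    simp [← ha, hπ, Matrix.mulVec, dotProduct, A, Finset.sum_apply, Pi.single_apply, mul_comm]
  obtain ⟨ψ, hψ, h⟩ := isCheinMatrix_of_det_ne_zero
    (A := A) ((Matrix.isUnit_iff_isUnit_det A).1 hA).ne_zero
  have e : φ = ψ := lieAut_ext_xg fun i => by rw [h, ← ha]; rfl
  rwa [e]

/-- The quadratic automorphism. -/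
theorem exists_quadratic_aut {i j k : Fin n} (hj : j ≠ i) (hk : k ≠ i) :
    ∃ e : FreeMetabelianLie K n ≃ₗ⁅K⁆ FreeMetabelianLie K n,
      e (xg K n i) = xg K n i + ⁅xg K n j, xg K n k⁆ ∧ ∀ b, b ≠ i → e (xg K n b) = xg K n b := by
  have h : ∀ F : FreeMetabelianLie K n →ₗ⁅K⁆ FreeMetabelianLie K n,
      (∀ b, b ≠ i → F (xg K n b) = xg K n b) →
      F ⁅xg K n j, xg K n k⁆ = ⁅xg K n j, xg K n k⁆ := fun F hF => by
    rw [LieHom.map_lie, hF j hj, hF k hk]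
  simpa using exists_lieAut_single i one_ne_zero ⁅xg K n j, xg K n k⁆ (fun F _ => h F)
    (fun F _ => h F)

/-- The cubic automorphism. -/
theorem exists_cubic_aut {i j k : Fin n} (hj : j ≠ i) (hk : k ≠ i) :
    ∃ e : FreeMetabelianLie K n ≃ₗ⁅K⁆ FreeMetabelianLie K n,
      e (xg K n i) = xg K n i + ⁅⁅xg K n j, xg K n k⁆, xg K n i⁆ ∧
        ∀ b, b ≠ i → e (xg K n b) = xg K n b := by
  simpa using exists_lieAut_single i one_ne_zero ⁅⁅xg K n j, xg K n k⁆, xg K n i⁆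
    (fun F hi hF => by
      rw [LieHom.map_lie, LieHom.map_lie, hF j hj, hF k hk, hi, lie_add, lie_lie_lie_lie,
        add_zero, one_smul])
    (fun F hi hF => by
      rw [LieHom.map_lie, LieHom.map_lie, hF j hj, hF k hk, hi, inv_one, one_smul, lie_sub,
        lie_lie_lie_lie, sub_zero])

end Metabelian

/-- **Corollary 1.** Over a field `K`, with `n ≥ 4` and `char K ≠ 3`, or `n ≥ 5`, the group
of almost tame automorphisms of `Mₙ` (the subgroup generated by all Chein automorphisms) is
generated by the linear automorphisms `GLₙ(K)` together with the quadratic automorphism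
`(x₁ + [x₂,x₃], x₂, …, xₙ)` and the cubic automorphism `(x₁ + [[x₂,x₃],x₁], x₂, …, xₙ)`. -/
theorem almost_tame_group_generated_by_linear_quadratic_cubic
    (K : Type) [Field K] (n : ℕ) (hn : 0 < n)
    (hK : (4 ≤ n ∧ ringChar K ≠ 3) ∨ 5 ≤ n)
    (i0 i1 i2 : Fin n) (h0 : (i0 : ℕ) = 0) (h1 : (i1 : ℕ) = 1) (h2 : (i2 : ℕ) = 2) :
    Subgroup.closure {φ : FreeMetabelianLie K n ≃ₗ⁅K⁆ FreeMetabelianLie K n | IsCheinAut K n φ}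
      = Subgroup.closure
        ({φ : FreeMetabelianLie K n ≃ₗ⁅K⁆ FreeMetabelianLie K n |
            ∀ i : Fin n, φ (xg K n i) ∈ Submodule.span K (Set.range (xg K n))} ∪
         {φ : FreeMetabelianLie K n ≃ₗ⁅K⁆ FreeMetabelianLie K n |
            φ (xg K n i0) = xg K n i0 + ⁅xg K n i1, xg K n i2⁆ ∧
            ∀ j : Fin n, j ≠ i0 → φ (xg K n j) = xg K n j} ∪
         {φ : FreeMetabelianLie K n ≃ₗ⁅K⁆ FreeMetabelianLie K n |
            φ (xg K n i0) = xg K n i0 + ⁅⁅xg K n i1, xg K n i2⁆, xg K n i0⁆ ∧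
            ∀ j : Fin n, j ≠ i0 → φ (xg K n j) = xg K n j}) := by
  have h10 : i1 ≠ i0 := fun h => by subst h; omega
  have h20 : i2 ≠ i0 := fun h => by subst h; omega
  have h12 : i1 ≠ i2 := fun h => by subst h; omega
  refine le_antisymm ((Subgroup.closure_le _).2 fun φ hφ => ?_)
    ((Subgroup.closure_le _).2 fun φ hφ => ?_)
  · obtain ⟨q, hq, hq'⟩ := exists_quadratic_aut (K := K) h10 h20
    obtain ⟨c, hc, hc'⟩ := exists_cubic_aut (K := K) h10 h20
    have hmem : ⁅xg K n i1, xg K n i2⁆ ∈ wordSpan (K := K) (· ≠ i0) :=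
      wordAct_mem_wordSpan (p := (· ≠ i0)) [] h10 h20
    exact IsCheinAut.mem_of_quadratic_cubic hK
      (fun ψ hψ => Subgroup.subset_closure (Or.inl (Or.inl hψ))) h10 h20 h12
      ⟨hmem, q, Subgroup.subset_closure (Or.inl (Or.inr ⟨hq, hq'⟩)), hq, hq'⟩
      ⟨lie_xg_mem_wordSpan hmem i0, c, Subgroup.subset_closure (Or.inr ⟨hc, hc'⟩), hc, hc'⟩ hφ
  · obtain (hφ | hφ) | hφ := hφ
    · exact mem_closure_chein_of_linear hφ
    · exact Subgroup.subset_closure ⟨i0, hφ.2⟩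
    · exact Subgroup.subset_closure ⟨i0, hφ.2⟩
end

section
/- Let $K$ be a field and $n$ a positive integer such that either ($n\geq 4$ and $\mathrm{char}\,K\neq 3$) or $n\geq 5$. Then for every $a\in U=K[y_1,\ldots,y_n]$ with $\mathrm{ldeg}(a)\geq 2$, the automorphism $D(a)=(x_1+[x_1,x_2]y_1a,\ x_2+[x_1,x_2]y_2a,\ x_3,\ldots,x_n)$ of $M_n$ is tame. -/
open MvPolynomial

noncomputable section Tameness

variable {K : Type} [Field K] {n : ℕ}

theorem derivedSeries_two_eq_bot : LieAlgebra.derivedSeries K (FreeMetabelianLie K n) 2 = ⊥ := by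
  let q : FreeLieAlgebra K (Fin n) →ₗ⁅K⁆ FreeMetabelianLie K n :=
    { (LieAlgebra.derivedSeries K (FreeLieAlgebra K (Fin n)) 2).toSubmodule.mkQ with
      map_lie' := fun {_ _} => rfl }
  have hq : Function.Surjective q := Submodule.mkQ_surjective _
  rw [← LieIdeal.derivedSeries_map_eq 2 hq, LieIdeal.map_eq_bot_iff]
  intro z hz
  rw [LieHom.mem_ker]
  exact (LieSubmodule.Quotient.mk_eq_zero' (N := LieAlgebra.derivedSeries K _ 2)).2 hz

variable (K n) in
/-- The derived ideal `[M, M]` of the free metabelian Lie algebra. -/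
abbrev derivedIdeal : LieIdeal K (FreeMetabelianLie K n) :=
  LieAlgebra.derivedSeries K (FreeMetabelianLie K n) 1

theorem lie_mem_derivedIdeal (u v : FreeMetabelianLie K n) : ⁅u, v⁆ ∈ derivedIdeal K n := by
  exact LieSubmodule.lie_mem_lie (I := (⊤ : LieIdeal K (FreeMetabelianLie K n)))
    (N := (⊤ : LieIdeal K (FreeMetabelianLie K n))) (LieSubmodule.mem_top u)
    (LieSubmodule.mem_top v)

theorem lie_eq_zero_of_mem_derivedIdeal {u v : FreeMetabelianLie K n}
    (hu : u ∈ derivedIdeal K n) (hv : v ∈ derivedIdeal K n) : ⁅u, v⁆ = 0 := by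
  have h : ⁅u, v⁆ ∈ LieAlgebra.derivedSeries K (FreeMetabelianLie K n) 2 :=
    LieSubmodule.lie_mem_lie (I := derivedIdeal K n) (N := derivedIdeal K n) hu hv
  rwa [derivedSeries_two_eq_bot, LieSubmodule.mem_bot] at h

/-- The endomorphism of the free metabelian Lie algebra with `xᵢ ↦ f i`. -/
def liftGen (f : Fin n → FreeMetabelianLie K n) :
    FreeMetabelianLie K n →ₗ⁅K⁆ FreeMetabelianLie K n :=
  { (LieAlgebra.derivedSeries K (FreeLieAlgebra K (Fin n)) 2).toSubmodule.liftQ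
      (FreeLieAlgebra.lift K f : FreeLieAlgebra K (Fin n) →ₗ[K] FreeMetabelianLie K n) (by
        intro z hz
        have h : FreeLieAlgebra.lift K f z ∈
            LieAlgebra.derivedSeries K (FreeMetabelianLie K n) 2 :=
          LieIdeal.derivedSeries_map_le 2 (LieIdeal.mem_map hz)
        rw [derivedSeries_two_eq_bot, LieSubmodule.mem_bot] at h
        exact h) with
    map_lie' := by
      rintro ⟨u⟩ ⟨v⟩
      exact LieHom.map_lie (FreeLieAlgebra.lift K f) u v }

@[simp]
theorem liftGen_xg (f : Fin n → FreeMetabelianLie K n) (i : Fin n) :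
    liftGen f (xg K n i) = f i :=
  FreeLieAlgebra.lift_of_apply f i

theorem freeMetabelianLie_hom_ext {f g : FreeMetabelianLie K n →ₗ⁅K⁆ FreeMetabelianLie K n}
    (h : ∀ i, f (xg K n i) = g (xg K n i)) : f = g := by
  let q : FreeLieAlgebra K (Fin n) →ₗ⁅K⁆ FreeMetabelianLie K n :=
    { (LieAlgebra.derivedSeries K (FreeLieAlgebra K (Fin n)) 2).toSubmodule.mkQ with
      map_lie' := fun {_ _} => rfl }
  have hfg : f.comp q = g.comp q := FreeLieAlgebra.hom_ext h
  ext ⟨z⟩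
  exact LieHom.congr_fun hfg z

theorem lieHom_mem_derivedIdeal (f : FreeMetabelianLie K n →ₗ⁅K⁆ FreeMetabelianLie K n)
    {u : FreeMetabelianLie K n} (hu : u ∈ derivedIdeal K n) : f u ∈ derivedIdeal K n :=
  LieIdeal.derivedSeries_map_le 1 (LieIdeal.mem_map hu)

/-- The operator `m ↦ [m, xᵢ]` on the derived ideal. -/
def bracketGen (i : Fin n) : Module.End K (derivedIdeal K n) where
  toFun m := ⟨⁅(m : FreeMetabelianLie K n), xg K n i⁆, lie_mem_derivedIdeal _ _⟩
  map_add' _ _ := Subtype.ext (add_lie _ _ _)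
  map_smul' _ _ := Subtype.ext (smul_lie _ _ _)

theorem bracketGen_mul_comm (i j : Fin n) :
    bracketGen (K := K) i * bracketGen j = bracketGen j * bracketGen i := by
  ext m
  change ⁅⁅(m : FreeMetabelianLie K n), xg K n j⁆, xg K n i⁆ =
    ⁅⁅(m : FreeMetabelianLie K n), xg K n i⁆, xg K n j⁆
  rw [lie_lie, lie_lie, lie_eq_zero_of_mem_derivedIdeal m.2 (lie_mem_derivedIdeal _ _),
    lie_eq_zero_of_mem_derivedIdeal m.2 (lie_mem_derivedIdeal _ _),
    ← lie_skew (xg K n j) ⁅(m : FreeMetabelianLie K n), xg K n i⁆, lie_lie,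
    lie_eq_zero_of_mem_derivedIdeal m.2 (lie_mem_derivedIdeal _ _)]
  simp

variable (K n) in
/-- The commutative algebra of operators on the derived ideal generated by the
`m ↦ [m, xᵢ]`. -/
abbrev bracketAlgebra : Subalgebra K (Module.End K (derivedIdeal K n)) :=
  Algebra.adjoin K (Set.range bracketGen)

instance bracketAlgebra_commSemiring : CommSemiring (bracketAlgebra K n) :=
  { (inferInstance : Semiring (bracketAlgebra K n)) with
    mul_comm := (Algebra.isMulCommutative_adjoin K (by
      rintro _ ⟨i, rfl⟩ _ ⟨j, rfl⟩
      exact bracketGen_mul_comm i j)).is_comm.comm }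

/-- The operator `m ↦ [m, xᵢ]` as an element of `bracketAlgebra K n`. -/
def bracketGen' (i : Fin n) : bracketAlgebra K n :=
  ⟨bracketGen i, Algebra.subset_adjoin ⟨i, rfl⟩⟩

/-- The algebra homomorphism `K[y₁,…,yₙ] → End [M, M]` with `yᵢ` acting as `m ↦ [m, xᵢ]`. -/
def polyEnd : MvPolynomial (Fin n) K →ₐ[K] Module.End K (derivedIdeal K n) :=
  (bracketAlgebra K n).val.comp (aeval bracketGen')

theorem polyEnd_X (i : Fin n) : polyEnd (K := K) (X i) = bracketGen i := by
  simp [polyEnd, bracketGen']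

instance derivedIdealModule : Module (MvPolynomial (Fin n) K) (derivedIdeal K n) :=
  Module.compHom _ (polyEnd (K := K) (n := n)).toRingHom

theorem polyEnd_apply (a : MvPolynomial (Fin n) K) (m : derivedIdeal K n) :
    polyEnd a m = a • m := rfl

theorem coe_X_smul (i : Fin n) (m : derivedIdeal K n) :
    (((X i : MvPolynomial (Fin n) K) • m : derivedIdeal K n) : FreeMetabelianLie K n) =
      ⁅(m : FreeMetabelianLie K n), xg K n i⁆ := by
  rw [← polyEnd_apply, polyEnd_X]
  rfl

theorem C_smul_eq (c : K) (m : derivedIdeal K n) :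
    (C c : MvPolynomial (Fin n) K) • m = c • m := by
  rw [← polyEnd_apply, ← algebraMap_eq, AlgHom.commutes]
  rfl

theorem coe_bracketGen_list_prod (d : Fin n → ℕ) (l : List (Fin n)) (m : derivedIdeal K n) :
    (((l.map fun i => bracketGen (K := K) i ^ d i).prod m : derivedIdeal K n) :
      FreeMetabelianLie K n) =
    (l.map fun i => (-(LieAlgebra.ad K (FreeMetabelianLie K n) (xg K n i))) ^ d i).prod m := by
  have hpow (i : Fin n) (k : ℕ) (m : derivedIdeal K n) :
      (((bracketGen (K := K) i ^ k) m : derivedIdeal K n) : FreeMetabelianLie K n) =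
        ((-(LieAlgebra.ad K (FreeMetabelianLie K n) (xg K n i))) ^ k) m := by
    induction k generalizing m with
    | zero => rfl
    | succ k ih =>
      rw [pow_succ, pow_succ, Module.End.mul_apply, Module.End.mul_apply, ih]
      congr 1
      exact (lie_skew _ _).symm
  induction l with
  | nil => rfl
  | cons i l ih =>
    rw [List.map_cons, List.map_cons, List.prod_cons, List.prod_cons, Module.End.mul_apply,
      Module.End.mul_apply, hpow, ih]

theorem polyEnd_monomial (d : Fin n →₀ ℕ) (c : K) :
    polyEnd (monomial d c) = c • (List.ofFn fun i => bracketGen (K := K) i ^ d i).prod := by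
  have h : aeval (R := K) (bracketGen' (n := n)) (monomial d c) =
      c • (List.ofFn fun i => bracketGen' (K := K) i ^ d i).prod := by
    rw [aeval_monomial, List.prod_ofFn, Algebra.smul_def, Finsupp.prod_fintype _ _ (by simp)]
  rw [polyEnd, AlgHom.comp_apply, h, map_smul, map_list_prod, List.map_ofFn]
  rfl

theorem polyAct_eq_smul (a : MvPolynomial (Fin n) K) (m : derivedIdeal K n) :
    polyAct K n a m = (a • m : derivedIdeal K n) := by
  conv_rhs => rw [← polyEnd_apply, a.as_sum, map_sum]
  rw [polyAct, LinearMap.sum_apply, AddSubmonoidClass.coe_finsetSum]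
  refine Finset.sum_congr rfl fun d _ => ?_
  rw [polyEnd_monomial, LinearMap.smul_apply, LieSubmodule.coe_smul, List.ofFn_eq_map,
    List.ofFn_eq_map, coe_bracketGen_list_prod]

/-- The restriction of an endomorphism to the derived ideal. -/
def restrictDerived (f : FreeMetabelianLie K n →ₗ⁅K⁆ FreeMetabelianLie K n) :
    derivedIdeal K n →ₗ[K] derivedIdeal K n :=
  (f : FreeMetabelianLie K n →ₗ[K] FreeMetabelianLie K n).restrict
    fun _ hu => lieHom_mem_derivedIdeal f hu

theorem coe_restrictDerived (f : FreeMetabelianLie K n →ₗ⁅K⁆ FreeMetabelianLie K n)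
    (m : derivedIdeal K n) : (restrictDerived f m : FreeMetabelianLie K n) = f m := rfl

theorem restrictDerived_smul (f : FreeMetabelianLie K n →ₗ⁅K⁆ FreeMetabelianLie K n)
    (σ : MvPolynomial (Fin n) K →ₐ[K] MvPolynomial (Fin n) K)
    (hσ : ∀ (i : Fin n) (m : derivedIdeal K n),
      ⁅(m : FreeMetabelianLie K n), f (xg K n i)⁆ = (σ (X i) • m : derivedIdeal K n))
    (a : MvPolynomial (Fin n) K) (m : derivedIdeal K n) :
    restrictDerived f (a • m) = σ a • restrictDerived f m := by
  induction a using MvPolynomial.induction_on generalizing m with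
  | C c => rw [C_smul_eq, map_smul, ← algebraMap_eq, AlgHom.commutes, algebraMap_eq, C_smul_eq]
  | add a b ha hb => rw [add_smul, map_add, ha, hb, map_add, add_smul]
  | mul_X a i ha =>
    rw [mul_smul, ha, map_mul, mul_smul]
    congr 1
    apply Subtype.ext
    rw [coe_restrictDerived, coe_X_smul, LieHom.map_lie, ← coe_restrictDerived, hσ]

variable (K) in
/-- The bracket `[xₖ, xₗ]` as an element of the derived ideal. -/
def genBracket (k l : Fin n) : derivedIdeal K n :=
  ⟨⁅xg K n k, xg K n l⁆, lie_mem_derivedIdeal _ _⟩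

theorem genBracket_self (k : Fin n) : genBracket K k k = 0 :=
  Subtype.ext (lie_self _)

theorem genBracket_swap (k l : Fin n) : genBracket K k l = -genBracket K l k :=
  Subtype.ext (lie_skew _ _).symm

theorem X_smul_genBracket_jacobi (j k l : Fin n) :
    (X j : MvPolynomial (Fin n) K) • genBracket K k l +
      (X k : MvPolynomial (Fin n) K) • genBracket K l j +
      (X l : MvPolynomial (Fin n) K) • genBracket K j k = 0 := by
  apply Subtype.ext
  rw [LieSubmodule.coe_add, LieSubmodule.coe_add, coe_X_smul, coe_X_smul, coe_X_smul]
  change ⁅⁅xg K n k, xg K n l⁆, xg K n j⁆ + ⁅⁅xg K n l, xg K n j⁆, xg K n k⁆ +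
    ⁅⁅xg K n j, xg K n k⁆, xg K n l⁆ = 0
  have h := lie_jacobi (xg K n j) (xg K n k) (xg K n l)
  rw [← lie_skew (xg K n j), ← lie_skew (xg K n k) ⁅_, _⁆, ← lie_skew (xg K n l) ⁅_, _⁆,
    ← neg_add, ← neg_add, neg_eq_zero] at h
  exact h

/-- The endomorphism `xᵢ ↦ xᵢ + mᵢ` for a tuple `m` of elements of the derived ideal. -/
def shift (m : Fin n → derivedIdeal K n) : FreeMetabelianLie K n →ₗ⁅K⁆ FreeMetabelianLie K n :=
  liftGen fun i => xg K n i + m i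

theorem shift_xg (m : Fin n → derivedIdeal K n) (i : Fin n) :
    shift m (xg K n i) = xg K n i + m i :=
  liftGen_xg _ _

/-- The restriction of `shift m` to the derived ideal, a homomorphism of `K[y₁,…,yₙ]`-modules. -/
def shiftDerived (m : Fin n → derivedIdeal K n) :
    derivedIdeal K n →ₗ[MvPolynomial (Fin n) K] derivedIdeal K n :=
  { restrictDerived (shift m) with
    map_smul' := fun a u => by
      refine restrictDerived_smul (shift m) (AlgHom.id K _) (fun i v => ?_) a u
      rw [shift_xg, lie_add, lie_eq_zero_of_mem_derivedIdeal v.2 (m i).2, add_zero]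
      exact (coe_X_smul i v).symm }

theorem coe_shiftDerived (m : Fin n → derivedIdeal K n) (u : derivedIdeal K n) :
    (shiftDerived m u : FreeMetabelianLie K n) = shift m u := rfl

theorem shiftDerived_genBracket (m : Fin n → derivedIdeal K n) (k l : Fin n) :
    shiftDerived m (genBracket K k l) = genBracket K k l +
      (X l : MvPolynomial (Fin n) K) • m k - (X k : MvPolynomial (Fin n) K) • m l := by
  apply Subtype.ext
  rw [coe_shiftDerived, LieSubmodule.coe_sub, LieSubmodule.coe_add, coe_X_smul, coe_X_smul]
  change shift m ⁅xg K n k, xg K n l⁆ = ⁅xg K n k, xg K n l⁆ + _ - _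
  rw [LieHom.map_lie, shift_xg, shift_xg, add_lie, lie_add, lie_add,
    lie_eq_zero_of_mem_derivedIdeal (m k).2 (m l).2, ← lie_skew (m l : FreeMetabelianLie K n)]
  abel

/-- The tuple `m` of elements of the derived ideal defines a tame automorphism `xᵢ ↦ xᵢ + mᵢ`. -/
def IsTameShift (m : Fin n → derivedIdeal K n) : Prop :=
  ∃ φ : FreeMetabelianLie K n ≃ₗ⁅K⁆ FreeMetabelianLie K n, IsTame K n φ ∧ ∀ u, φ u = shift m u

theorem isTameShift_of_xg {m : Fin n → derivedIdeal K n}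
    {φ : FreeMetabelianLie K n ≃ₗ⁅K⁆ FreeMetabelianLie K n} (hφ : IsTame K n φ)
    (h : ∀ i, φ (xg K n i) = xg K n i + m i) : IsTameShift m := by
  refine ⟨φ, hφ, fun u => ?_⟩
  refine LieHom.congr_fun (f := (φ : FreeMetabelianLie K n →ₗ⁅K⁆ FreeMetabelianLie K n)) ?_ u
  exact freeMetabelianLie_hom_ext fun i => (h i).trans (shift_xg m i).symm

theorem IsTameShift.isTame {m : Fin n → derivedIdeal K n} (hm : IsTameShift m)
    {φ : FreeMetabelianLie K n ≃ₗ⁅K⁆ FreeMetabelianLie K n}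
    (h : ∀ i, φ (xg K n i) = xg K n i + m i) : IsTame K n φ := by
  obtain ⟨ψ, hψ, hψm⟩ := hm
  have hφψ : (φ : FreeMetabelianLie K n →ₗ⁅K⁆ FreeMetabelianLie K n) = ψ :=
    freeMetabelianLie_hom_ext fun i => (h i).trans (by
      rw [← shift_xg m i]
      exact (hψm _).symm)
  rwa [show φ = ψ from LieEquiv.ext fun u => LieHom.congr_fun hφψ u]

theorem IsTameShift.comp {m m' : Fin n → derivedIdeal K n} (hm : IsTameShift m)
    (hm' : IsTameShift m') : IsTameShift fun i => m i + shiftDerived m (m' i) := by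
  obtain ⟨φ, hφ, hφm⟩ := hm
  obtain ⟨ψ, hψ, hψm⟩ := hm'
  refine isTameShift_of_xg (φ := φ * ψ) (mul_mem hφ hψ) fun i => ?_
  change φ (ψ (xg K n i)) = _
  rw [hψm, shift_xg, hφm, map_add, shift_xg, LieSubmodule.coe_add, coe_shiftDerived, add_assoc]

theorem IsTameShift.add {m m' : Fin n → derivedIdeal K n} (hm : IsTameShift m)
    (hm' : IsTameShift m') (h : ∀ i, shiftDerived m (m' i) = m' i) :
    IsTameShift fun i => m i + m' i := by
  simpa only [h] using hm.comp hm'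

theorem IsTameShift.neg {m : Fin n → derivedIdeal K n} (hm : IsTameShift m)
    (h : ∀ i, shiftDerived m (m i) = m i) : IsTameShift fun i => -m i := by
  obtain ⟨φ, hφ, hφm⟩ := hm
  refine isTameShift_of_xg (φ := φ⁻¹) (inv_mem hφ) fun i => ?_
  change φ.symm (xg K n i) = _
  rw [LieEquiv.symm_apply_eq, hφm, map_add, shift_xg, ← coe_shiftDerived, map_neg, h]
  simp

theorem IsTameShift.conj {m m' : Fin n → derivedIdeal K n} (hm : IsTameShift m)
    (hm' : IsTameShift m') (h : ∀ i, shiftDerived m (m i) = m i)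
    (h' : ∀ i, shiftDerived m' (m i) = m i) :
    IsTameShift fun i => shiftDerived m (m' i) := by
  obtain ⟨φ, hφ, hφm⟩ := hm
  obtain ⟨ψ, hψ, hψm⟩ := hm'
  refine isTameShift_of_xg (φ := φ * ψ * φ⁻¹) (mul_mem (mul_mem hφ hψ) (inv_mem hφ)) fun i => ?_
  change φ (ψ (φ.symm (xg K n i))) = _
  have h1 : φ.symm (xg K n i) = xg K n i - m i := by
    rw [LieEquiv.symm_apply_eq, hφm, map_sub, shift_xg, ← coe_shiftDerived, h, add_sub_cancel_right]
  rw [h1, hψm, map_sub, shift_xg, ← coe_shiftDerived, h', hφm, map_sub, map_add, shift_xg,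
    ← coe_shiftDerived, ← coe_shiftDerived, h]
  abel

/-- The group commutator of two shifts, in the case where only one of the two cross terms is
nonzero and is fixed by everything. -/
theorem IsTameShift.commutator {m m' : Fin n → derivedIdeal K n} (hm : IsTameShift m)
    (hm' : IsTameShift m') (h : ∀ i, shiftDerived m (m i) = m i)
    (h' : ∀ i, shiftDerived m' (m i) = m i) (h'' : ∀ i, shiftDerived m' (m' i) = m' i)
    (hq : ∀ i, shiftDerived (fun i => -m' i) (shiftDerived m (m' i)) = shiftDerived m (m' i)) :
    IsTameShift fun i => shiftDerived m (m' i) - m' i := by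
  have := (hm'.neg h'').add (hm.conj hm' h h') hq
  simpa only [neg_add_eq_sub] using this

theorem exists_isTame_xg_add {i : Fin n} {f : FreeMetabelianLie K n}
    (hf : f ∈ LieSubalgebra.lieSpan K (FreeMetabelianLie K n) (xg K n '' {j | j ≠ i})) :
    ∃ φ : FreeMetabelianLie K n ≃ₗ⁅K⁆ FreeMetabelianLie K n, IsTame K n φ ∧
      φ (xg K n i) = xg K n i + f ∧ ∀ j, j ≠ i → φ (xg K n j) = xg K n j := by
  let E (g : FreeMetabelianLie K n) : FreeMetabelianLie K n →ₗ⁅K⁆ FreeMetabelianLie K n :=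
    liftGen fun j => if j = i then xg K n i + g else xg K n j
  have hi (g) : E g (xg K n i) = xg K n i + g := by simp [E]
  have hj (g) (j) (h : j ≠ i) : E g (xg K n j) = xg K n j := by simp [E, h]
  have hfix (g) : E g f = f := by
    induction hf using LieSubalgebra.lieSpan_induction with
    | mem x hx =>
      obtain ⟨j, hji, rfl⟩ := hx
      exact hj g j hji
    | zero => simp
    | add x y _ _ hx hy => rw [map_add, hx, hy]
    | smul c x _ hx => rw [map_smul, hx]
    | lie x y _ _ hx hy => rw [LieHom.map_lie, hx, hy]
  have hcomp (g g' : FreeMetabelianLie K n) (hg : E g g' = g') (h : g + g' = 0) (u) :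
      E g (E g' u) = u := by
    refine LieHom.congr_fun (f := (E g).comp (E g')) (g := LieHom.id)
      (freeMetabelianLie_hom_ext fun j => ?_) u
    by_cases hji : j = i
    · subst hji
      rw [LieHom.comp_apply, hi, map_add, hi, hg, add_assoc, h, add_zero, LieHom.id_apply]
    · rw [LieHom.comp_apply, hj _ _ hji, hj _ _ hji, LieHom.id_apply]
  let φ : FreeMetabelianLie K n ≃ₗ⁅K⁆ FreeMetabelianLie K n :=
    { E f with
      invFun := E (-f)
      left_inv := hcomp (-f) f (hfix _) (neg_add_cancel f)
      right_inv := hcomp f (-f) (by rw [map_neg, hfix]) (add_neg_cancel f) }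
  refine ⟨φ, Subgroup.subset_closure ⟨i, 1, f, one_ne_zero, hf, ?_, fun j h => hj f j h⟩,
    hi f, fun j h => hj f j h⟩
  rw [one_smul]
  exact hi f

theorem isTameShift_single_of_mem_lieSpan {i : Fin n} {m : derivedIdeal K n}
    (hm : (m : FreeMetabelianLie K n) ∈
      LieSubalgebra.lieSpan K (FreeMetabelianLie K n) (xg K n '' {j | j ≠ i})) :
    IsTameShift (Pi.single i m) := by
  obtain ⟨φ, hφ, hi, hj⟩ := exists_isTame_xg_add hm
  refine isTameShift_of_xg hφ fun j => ?_
  by_cases h : j = i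
  · subst h
    rw [hi, Pi.single_eq_same]
  · rw [hj j h, Pi.single_eq_of_ne h, LieSubmodule.coe_zero, add_zero]

theorem smul_mem_lieSpan {i : Fin n} {a : MvPolynomial (Fin n) K}
    (ha : a ∈ supported K {j | j ≠ i}) {m : derivedIdeal K n}
    (hm : (m : FreeMetabelianLie K n) ∈
      LieSubalgebra.lieSpan K (FreeMetabelianLie K n) (xg K n '' {j | j ≠ i})) :
    ((a • m : derivedIdeal K n) : FreeMetabelianLie K n) ∈
      LieSubalgebra.lieSpan K (FreeMetabelianLie K n) (xg K n '' {j | j ≠ i}) := by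
  induction ha using Algebra.adjoin_induction generalizing m with
  | mem x hx =>
    obtain ⟨j, hj, rfl⟩ := hx
    rw [coe_X_smul]
    exact LieSubalgebra.lie_mem _ hm (LieSubalgebra.subset_lieSpan ⟨j, hj, rfl⟩)
  | algebraMap c =>
    rw [algebraMap_eq, C_smul_eq, LieSubmodule.coe_smul]
    exact LieSubalgebra.smul_mem _ c hm
  | add x y _ _ hx hy =>
    rw [add_smul, LieSubmodule.coe_add]
    exact add_mem (hx hm) (hy hm)
  | mul x y _ _ hx hy =>
    rw [mul_smul]
    exact hx (hy hm)

theorem isTameShift_single_of_mem_supported {i k l : Fin n} (hk : k ≠ i) (hl : l ≠ i)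
    {a : MvPolynomial (Fin n) K} (ha : a ∈ supported K {j | j ≠ i}) :
    IsTameShift (Pi.single i (a • genBracket K k l)) :=
  isTameShift_single_of_mem_lieSpan <| smul_mem_lieSpan ha <|
    LieSubalgebra.lie_mem _ (LieSubalgebra.subset_lieSpan ⟨k, hk, rfl⟩)
      (LieSubalgebra.subset_lieSpan ⟨l, hl, rfl⟩)

variable (K) in
/-- The `K[y₁,…,yₙ]`-submodule of the derived ideal generated by the brackets `[xₖ, xₗ]` with
`k, l ≠ i`. -/
def bracketsAvoiding (i : Fin n) : Submodule (MvPolynomial (Fin n) K) (derivedIdeal K n) :=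
  Submodule.span _ {u | ∃ k l, k ≠ i ∧ l ≠ i ∧ u = genBracket K k l}

theorem genBracket_mem_bracketsAvoiding {i k l : Fin n} (hk : k ≠ i) (hl : l ≠ i) :
    genBracket K k l ∈ bracketsAvoiding K i :=
  Submodule.subset_span ⟨k, l, hk, hl, rfl⟩

theorem shiftDerived_single_of_mem {i : Fin n} (m : derivedIdeal K n) {u : derivedIdeal K n}
    (hu : u ∈ bracketsAvoiding K i) : shiftDerived (Pi.single i m) u = u := by
  induction hu using Submodule.span_induction with
  | mem x hx =>
    obtain ⟨k, l, hk, hl, rfl⟩ := hx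
    rw [shiftDerived_genBracket, Pi.single_eq_of_ne hk, Pi.single_eq_of_ne hl]
    simp
  | zero => simp
  | add x y _ _ hx hy => rw [map_add, hx, hy]
  | smul a x _ hx => rw [map_smul, hx]

theorem map_piSingle (f : derivedIdeal K n →+ derivedIdeal K n) (i : Fin n)
    (m : derivedIdeal K n) (t : Fin n) :
    f ((Pi.single i m : Fin n → derivedIdeal K n) t) =
      (Pi.single i (f m) : Fin n → derivedIdeal K n) t :=
  (Pi.apply_single (fun _ => f) (fun _ => map_zero f) i m t)

theorem shiftDerived_piSingle (m : Fin n → derivedIdeal K n) (i : Fin n)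
    (u : derivedIdeal K n) (t : Fin n) :
    shiftDerived m ((Pi.single i u : Fin n → derivedIdeal K n) t) =
      (Pi.single i (shiftDerived m u) : Fin n → derivedIdeal K n) t :=
  map_piSingle (shiftDerived m : derivedIdeal K n →+ derivedIdeal K n) i u t

theorem IsTameShift.single_add {i : Fin n} {m m' : derivedIdeal K n}
    (hm : IsTameShift (Pi.single i m)) (hm' : IsTameShift (Pi.single i m'))
    (h : m' ∈ bracketsAvoiding K i) : IsTameShift (Pi.single i (m + m')) := by
  have := hm.add hm' fun t => by
    rw [shiftDerived_piSingle, shiftDerived_single_of_mem _ h]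
  rw [Pi.single_add]
  exact this

theorem IsTameShift.single_commutator {i j p k l : Fin n} (hij : i ≠ j) (hpi : p ≠ i)
    (hpj : p ≠ j) (hki : k ≠ i) (hkj : k ≠ j) (hli : l ≠ i) (hlj : l ≠ j)
    {b c : MvPolynomial (Fin n) K} (hb : IsTameShift (Pi.single i (b • genBracket K j p)))
    (hc : IsTameShift (Pi.single j (c • genBracket K k l))) :
    IsTameShift (Pi.single i ((X p * (b * c)) • genBracket K k l)) := by
  have hkl : c • genBracket K k l ∈ bracketsAvoiding K j :=
    Submodule.smul_mem _ _ (genBracket_mem_bracketsAvoiding hkj hlj)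
  have hkl' : c • genBracket K k l ∈ bracketsAvoiding K i :=
    Submodule.smul_mem _ _ (genBracket_mem_bracketsAvoiding hki hli)
  have hjp : b • genBracket K j p ∈ bracketsAvoiding K i :=
    Submodule.smul_mem _ _ (genBracket_mem_bracketsAvoiding hij.symm hpi)
  have hval : shiftDerived (Pi.single j (c • genBracket K k l)) (b • genBracket K j p) =
      b • genBracket K j p + (X p * (b * c)) • genBracket K k l := by
    rw [map_smul, shiftDerived_genBracket, Pi.single_eq_same, Pi.single_eq_of_ne hpj]
    module
  have := hc.commutator hb
    (fun t => by rw [shiftDerived_piSingle, shiftDerived_single_of_mem _ hkl])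
    (fun t => by rw [shiftDerived_piSingle, shiftDerived_single_of_mem _ hkl'])
    (fun t => by rw [shiftDerived_piSingle, shiftDerived_single_of_mem _ hjp])
    (fun t => by
      rw [shiftDerived_piSingle, hval,
        show (fun i_1 => -(Pi.single i (b • genBracket K j p) : Fin n → derivedIdeal K n) i_1) =
          Pi.single i (-(b • genBracket K j p)) from (Pi.single_neg _ _).symm,
        shiftDerived_piSingle, shiftDerived_single_of_mem]
      exact add_mem hjp (Submodule.smul_mem _ _ (genBracket_mem_bracketsAvoiding hki hli)))
  convert this using 1
  funext t
  rw [shiftDerived_piSingle, hval, ← Pi.sub_apply, ← Pi.single_sub, add_sub_cancel_left]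

theorem isTameShift_single_X_mul_of_exists {i k l p j : Fin n} (hij : i ≠ j) (hpi : p ≠ i)
    (hpj : p ≠ j) (hki : k ≠ i) (hkj : k ≠ j) (hli : l ≠ i) (hlj : l ≠ j)
    (g : MvPolynomial (Fin n) K) :
    IsTameShift (Pi.single i ((X p * g) • genBracket K k l)) := by
  induction g using MvPolynomial.induction_on' with
  | monomial d c =>
    have h : (monomial d c : MvPolynomial (Fin n) K) = monomial (d.erase i) c * X i ^ d i := by
      rw [X_pow_eq_monomial, monomial_mul, mul_one, add_comm, Finsupp.single_add_erase]
    rw [h]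
    refine IsTameShift.single_commutator hij hpi hpj hki hkj hli hlj
      (isTameShift_single_of_mem_supported hij.symm hpi ?_)
      (isTameShift_single_of_mem_supported hkj hlj ?_)
    · rw [mem_supported]
      rintro t ht rfl
      obtain ⟨e, he, hte⟩ := mem_vars_iff_mem_support _ |>.1 ht
      rw [Finset.mem_singleton.1 (support_monomial_subset he)] at hte
      simp at hte
    · exact pow_mem (X_mem_supported.2 hij) _
  | add a b ha hb =>
    rw [mul_add, add_smul]
    exact ha.single_add hb (Submodule.smul_mem _ _ (genBracket_mem_bracketsAvoiding hki hli))

variable (K) in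
/-- The endomorphism with `x_a ↦ x_a + x_b` fixing the other generators. -/
def transvection (a b : Fin n) : FreeMetabelianLie K n →ₗ⁅K⁆ FreeMetabelianLie K n :=
  liftGen fun c => if c = a then xg K n a + xg K n b else xg K n c

variable (K) in
/-- The substitution `y_a ↦ y_a + y_b` fixing the other variables. -/
def polyTransvection (a b : Fin n) : MvPolynomial (Fin n) K →ₐ[K] MvPolynomial (Fin n) K :=
  aeval fun c => if c = a then X a + X b else X c

theorem polyTransvection_X_self (a b : Fin n) :
    polyTransvection K a b (X a) = X a + X b := by
  simp [polyTransvection]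

theorem polyTransvection_X_of_ne {a c : Fin n} (h : c ≠ a) (b : Fin n) :
    polyTransvection K a b (X c) = X c := by
  simp [polyTransvection, h]

theorem polyTransvection_surjective {a b : Fin n} (h : a ≠ b) :
    Function.Surjective (polyTransvection K a b) := by
  intro g
  refine ⟨aeval (fun c => if c = a then X a - X b else X c) g, ?_⟩
  rw [← AlgHom.comp_apply]
  refine DFunLike.congr_fun (g := AlgHom.id K _) (algHom_ext fun c => ?_) g
  by_cases hc : c = a
  · subst hc
    rw [AlgHom.comp_apply, aeval_X, if_pos rfl, map_sub, polyTransvection_X_self,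
      polyTransvection_X_of_ne h.symm, add_sub_cancel_right, AlgHom.id_apply]
  · rw [AlgHom.comp_apply, aeval_X, if_neg hc, polyTransvection_X_of_ne hc, AlgHom.id_apply]

theorem transvection_xg_self (a b : Fin n) :
    transvection K a b (xg K n a) = xg K n a + xg K n b := by
  simp [transvection]

theorem transvection_xg_of_ne {a c : Fin n} (h : c ≠ a) (b : Fin n) :
    transvection K a b (xg K n c) = xg K n c := by
  simp [transvection, h]

theorem restrictDerived_transvection_smul (a b : Fin n) (g : MvPolynomial (Fin n) K)
    (u : derivedIdeal K n) :
    restrictDerived (transvection K a b) (g • u) =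
      polyTransvection K a b g • restrictDerived (transvection K a b) u := by
  refine restrictDerived_smul _ _ (fun c v => ?_) g u
  by_cases hc : c = a
  · subst hc
    rw [transvection_xg_self, polyTransvection_X_self, add_smul, LieSubmodule.coe_add, coe_X_smul,
      coe_X_smul, lie_add]
  · rw [transvection_xg_of_ne hc, polyTransvection_X_of_ne hc, coe_X_smul]

theorem transvection_genBracket_of_ne {a k l : Fin n} (hk : k ≠ a) (hl : l ≠ a) (b : Fin n) :
    restrictDerived (transvection K a b) (genBracket K k l) = genBracket K k l := by
  apply Subtype.ext
  change transvection K a b ⁅xg K n k, xg K n l⁆ = ⁅xg K n k, xg K n l⁆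
  rw [LieHom.map_lie, transvection_xg_of_ne hk, transvection_xg_of_ne hl]

theorem transvection_genBracket_left {a l : Fin n} (hl : l ≠ a) (b : Fin n) :
    restrictDerived (transvection K a b) (genBracket K a l) =
      genBracket K a l + genBracket K b l := by
  apply Subtype.ext
  change transvection K a b ⁅xg K n a, xg K n l⁆ = ⁅xg K n a, xg K n l⁆ + ⁅xg K n b, xg K n l⁆
  rw [LieHom.map_lie, transvection_xg_self, transvection_xg_of_ne hl, add_lie]

theorem IsTameShift.conj_transvection {m : Fin n → derivedIdeal K n} (hm : IsTameShift m)
    {a b : Fin n} (hab : a ≠ b) :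
    IsTameShift fun c => restrictDerived (transvection K a b)
      (m c - (Pi.single a (m b) : Fin n → derivedIdeal K n) c) := by
  obtain ⟨φ, hφ, hφm⟩ := hm
  obtain ⟨g, hg, hga, hgc⟩ := exists_isTame_xg_add (K := K) (i := a) (f := xg K n b)
    (LieSubalgebra.subset_lieSpan ⟨b, hab.symm, rfl⟩)
  have hgu (u) : g u = transvection K a b u := by
    refine LieHom.congr_fun (f := (g : FreeMetabelianLie K n →ₗ⁅K⁆ FreeMetabelianLie K n))
      (freeMetabelianLie_hom_ext fun c => ?_) u
    by_cases hc : c = a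
    · subst hc
      exact hga.trans (transvection_xg_self _ _).symm
    · exact (hgc c hc).trans (transvection_xg_of_ne hc b).symm
  refine isTameShift_of_xg (φ := g * φ * g⁻¹) (mul_mem (mul_mem hg hφ) (inv_mem hg)) fun c => ?_
  change g (φ (g.symm (xg K n c))) = _
  by_cases hc : c = a
  · subst hc
    have h1 : g.symm (xg K n c) = xg K n c - xg K n b := by
      rw [LieEquiv.symm_apply_eq, map_sub, hga, hgc b hab.symm, add_sub_cancel_right]
    rw [h1, hφm, map_sub, shift_xg, shift_xg, Pi.single_eq_same, coe_restrictDerived, ← hgu,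
      LieSubmodule.coe_sub,
      show xg K n c + (m c : FreeMetabelianLie K n) - (xg K n b + m b) =
        xg K n c - xg K n b + (m c - m b) by abel, map_add g, ← h1, LieEquiv.apply_symm_apply]
  · have h1 : g.symm (xg K n c) = xg K n c := by
      rw [LieEquiv.symm_apply_eq, hgc c hc]
    rw [h1, hφm, shift_xg, Pi.single_eq_of_ne hc, sub_zero, map_add, hgc c hc,
      coe_restrictDerived, hgu]

theorem IsTameShift.single_transvection {i a b : Fin n} {m : derivedIdeal K n}
    (hm : IsTameShift (Pi.single i m)) (hab : a ≠ b) (hib : i ≠ b) :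
    IsTameShift (Pi.single i (restrictDerived (transvection K a b) m)) := by
  convert hm.conj_transvection hab using 1
  funext c
  rw [Pi.single_eq_of_ne hib.symm, Pi.single_zero, Pi.zero_apply, sub_zero]
  exact (map_piSingle (restrictDerived (transvection K a b) : _ →ₗ[K] _).toAddMonoidHom
    i m c).symm

theorem isTameShift_single_X_mul_left (hn : 4 ≤ n) {i k l : Fin n} (hki : k ≠ i) (hli : l ≠ i)
    (g : MvPolynomial (Fin n) K) :
    IsTameShift (Pi.single i ((X k * g) • genBracket K k l)) := by
  obtain ⟨j, hj⟩ : ∃ j, j ∉ ({i, k, l} : Finset (Fin n)) :=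
    Finset.exists_mem_notMem_of_card_lt_card (s := {i, k, l}) (t := Finset.univ)
      (Finset.card_le_three.trans_lt (by simp; lia)) |>.imp fun _ h => h.2
  simp only [Finset.mem_insert, Finset.mem_singleton, not_or] at hj
  exact isTameShift_single_X_mul_of_exists (Ne.symm hj.1) hki (Ne.symm hj.2.1) hki
    (Ne.symm hj.2.1) hli (Ne.symm hj.2.2) g

theorem isTameShift_single_X_mul_right (hn : 4 ≤ n) {i k l : Fin n} (hki : k ≠ i) (hli : l ≠ i)
    (g : MvPolynomial (Fin n) K) :
    IsTameShift (Pi.single i ((X l * g) • genBracket K k l)) := by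
  have := isTameShift_single_X_mul_left hn hli hki (-g)
  rwa [genBracket_swap, mul_neg, neg_smul_neg] at this

/-- The element `y_p [xₖ, xₗ] - yₖ [x_l, x_p]`, times any polynomial. -/
theorem isTameShift_single_jacobi_sub (hn : 4 ≤ n) {i k l p : Fin n} (hki : k ≠ i) (hli : l ≠ i)
    (hpi : p ≠ i) (hkl : k ≠ l) (hkp : k ≠ p) (g : MvPolynomial (Fin n) K) :
    IsTameShift (Pi.single i
      (g • ((X p : MvPolynomial (Fin n) K) • genBracket K k l -
        (X k : MvPolynomial (Fin n) K) • genBracket K l p))) := by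
  obtain ⟨h, rfl⟩ := polyTransvection_surjective hkp g
  have h1 := (isTameShift_single_X_mul_left hn hki hli h).single_transvection hkp hpi.symm
  rw [restrictDerived_transvection_smul, transvection_genBracket_left hkl.symm, map_mul,
    polyTransvection_X_self] at h1
  have hmem {s t : Fin n} (hs : s ≠ i) (ht : t ≠ i) (f : MvPolynomial (Fin n) K) :
      f • genBracket K s t ∈ bracketsAvoiding K i :=
    Submodule.smul_mem _ _ (genBracket_mem_bracketsAvoiding hs ht)
  have h2 := (h1.single_add (isTameShift_single_X_mul_left hn hki hli
    (-polyTransvection K k p h)) (hmem hki hli _)).single_add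
    (isTameShift_single_X_mul_left hn hpi hli (-polyTransvection K k p h))
    (hmem hpi hli _)
  convert h2 using 2
  rw [genBracket_swap l p]
  module

theorem isTameShift_single_X_mul (hK : (4 ≤ n ∧ ringChar K ≠ 3) ∨ 5 ≤ n) {i k l p : Fin n}
    (hki : k ≠ i) (hli : l ≠ i) (hpi : p ≠ i) (g : MvPolynomial (Fin n) K) :
    IsTameShift (Pi.single i ((X p * g) • genBracket K k l)) := by
  have hn : 4 ≤ n := hK.elim (fun h => h.1) (fun h => by lia)
  by_cases hkl : k = l
  · subst hkl
    have := isTameShift_single_of_mem_supported (K := K) hki hki (zero_mem (supported K _))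
    simpa [genBracket_self] using this
  by_cases hpk : p = k
  · subst hpk
    exact isTameShift_single_X_mul_left hn hki hli g
  by_cases hpl : p = l
  · subst hpl
    exact isTameShift_single_X_mul_right hn hki hli g
  rcases hK with ⟨-, hchar⟩ | hn5
  · have h3 : (3 : K) ≠ 0 := fun h => hchar <|
      CharP.ringChar_of_prime_eq_zero Nat.prime_three (by exact_mod_cast h)
    have hmem {s t : Fin n} (hs : s ≠ i) (ht : t ≠ i) (f : MvPolynomial (Fin n) K) :
        f • genBracket K s t ∈ bracketsAvoiding K i :=
      Submodule.smul_mem _ _ (genBracket_mem_bracketsAvoiding hs ht)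
    have h1 := isTameShift_single_jacobi_sub hn hki hli hpi hkl (Ne.symm hpk)
      (C (3⁻¹) * g)
    have h2 := isTameShift_single_jacobi_sub hn hli hki hpi (Ne.symm hkl) (Ne.symm hpl)
      (-(C (3⁻¹) * g))
    have h12 := h1.single_add h2 (by
      refine Submodule.smul_mem _ _ (sub_mem ?_ ?_)
      · exact hmem hli hki _
      · exact hmem hki hpi _)
    have hJ := X_smul_genBracket_jacobi (K := K) p k l
    have hC : (C (3⁻¹ : K) : MvPolynomial (Fin n) K) * 3 = 1 := by
      rw [show (3 : MvPolynomial (Fin n) K) = C 3 from (map_ofNat C 3).symm, ← C_mul,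
        inv_mul_cancel₀ h3, C_1]
    convert h12 using 2
    rw [genBracket_swap l k, genBracket_swap k p]
    have e : (X p * g) • genBracket K k l =
        ((C (3⁻¹ : K) : MvPolynomial (Fin n) K) * 3) • (X p * g) • genBracket K k l -
        (C (3⁻¹ : K) * g) • ((X p : MvPolynomial (Fin n) K) • genBracket K k l +
      (X k : MvPolynomial (Fin n) K) • genBracket K l p +
      (X l : MvPolynomial (Fin n) K) • genBracket K p k) := by
      rw [hJ, hC, smul_zero, sub_zero, one_smul]
    rw [e]
    module
  · obtain ⟨j, hj⟩ : ∃ j, j ∉ ({i, k, l, p} : Finset (Fin n)) :=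
      Finset.exists_mem_notMem_of_card_lt_card (s := {i, k, l, p}) (t := Finset.univ)
        (Finset.card_le_four.trans_lt (by simp; lia)) |>.imp fun _ h => h.2
    simp only [Finset.mem_insert, Finset.mem_singleton, not_or] at hj
    exact isTameShift_single_X_mul_of_exists (Ne.symm hj.1) hpi (Ne.symm hj.2.2.2) hki
      (Ne.symm hj.2.1) hli (Ne.symm hj.2.2.1) g

/-- The tuple with entries `y_p u` and `y_q u` at the positions `p` and `q`. -/
def pairTuple (p q : Fin n) (u : derivedIdeal K n) : Fin n → derivedIdeal K n :=
  Pi.single p ((X p : MvPolynomial (Fin n) K) • u) +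
    Pi.single q ((X q : MvPolynomial (Fin n) K) • u)

theorem pairTuple_left {p q : Fin n} (hpq : p ≠ q) (u : derivedIdeal K n) :
    pairTuple p q u p = (X p : MvPolynomial (Fin n) K) • u := by
  rw [pairTuple, Pi.add_apply, Pi.single_eq_same, Pi.single_eq_of_ne hpq, add_zero]

theorem pairTuple_right {p q : Fin n} (hpq : p ≠ q) (u : derivedIdeal K n) :
    pairTuple p q u q = (X q : MvPolynomial (Fin n) K) • u := by
  rw [pairTuple, Pi.add_apply, Pi.single_eq_same, Pi.single_eq_of_ne hpq.symm, zero_add]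

theorem pairTuple_of_ne {p q t : Fin n} (hp : t ≠ p) (hq : t ≠ q) (u : derivedIdeal K n) :
    pairTuple p q u t = 0 := by
  rw [pairTuple, Pi.add_apply, Pi.single_eq_of_ne hp, Pi.single_eq_of_ne hq, add_zero]

theorem map_pairTuple (f : derivedIdeal K n →+ derivedIdeal K n) {p q : Fin n}
    {u v : derivedIdeal K n}
    (hp : f ((X p : MvPolynomial (Fin n) K) • u) = (X p : MvPolynomial (Fin n) K) • v)
    (hq : f ((X q : MvPolynomial (Fin n) K) • u) = (X q : MvPolynomial (Fin n) K) • v)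
    (t : Fin n) : f (pairTuple p q u t) = pairTuple p q v t := by
  rw [pairTuple, pairTuple, Pi.add_apply, Pi.add_apply, map_add, map_piSingle, map_piSingle, hp, hq]

theorem shiftDerived_pairTuple (m : Fin n → derivedIdeal K n) (p q : Fin n)
    (u : derivedIdeal K n) (t : Fin n) :
    shiftDerived m (pairTuple p q u t) = pairTuple p q (shiftDerived m u) t :=
  map_pairTuple (shiftDerived m : derivedIdeal K n →+ derivedIdeal K n)
    (map_smul (shiftDerived m) _ _) (map_smul (shiftDerived m) _ _) t

theorem pairTuple_add (p q : Fin n) (u v : derivedIdeal K n) (t : Fin n) :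
    pairTuple p q (u + v) t = pairTuple p q u t + pairTuple p q v t := by
  simp only [pairTuple, Pi.add_apply, smul_add, Pi.single_add]
  abel

theorem pairTuple_neg (p q : Fin n) (u : derivedIdeal K n) (t : Fin n) :
    pairTuple p q (-u) t = -pairTuple p q u t := by
  simp only [pairTuple, Pi.add_apply, smul_neg, Pi.single_neg, Pi.neg_apply]
  abel

theorem shiftDerived_genBracket_eq_self {m : Fin n → derivedIdeal K n} {p q : Fin n}
    {u : derivedIdeal K n} (hp : m p = (X p : MvPolynomial (Fin n) K) • u)
    (hq : m q = (X q : MvPolynomial (Fin n) K) • u) :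
    shiftDerived m (genBracket K p q) = genBracket K p q := by
  rw [shiftDerived_genBracket, hp, hq, smul_comm, add_sub_cancel_right]

theorem shiftDerived_pairTuple_genBracket {p q : Fin n} (hpq : p ≠ q) (u : derivedIdeal K n) :
    shiftDerived (pairTuple p q u) (genBracket K p q) = genBracket K p q :=
  shiftDerived_genBracket_eq_self (pairTuple_left hpq u) (pairTuple_right hpq u)

theorem shiftDerived_pairTuple_genBracket_of_ne {p q r s : Fin n} (hrp : r ≠ p) (hrq : r ≠ q)
    (hsp : s ≠ p) (hsq : s ≠ q) (u : derivedIdeal K n) :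
    shiftDerived (pairTuple p q u) (genBracket K r s) = genBracket K r s := by
  rw [shiftDerived_genBracket, pairTuple_of_ne hrp hrq, pairTuple_of_ne hsp hsq]
  simp

/-- The automorphism `x_p ↦ x_p + [x_p, x_q] y_p f`, `x_q ↦ x_q + [x_p, x_q] y_q f` is tame. -/
def IsTameCohn (p q : Fin n) (f : MvPolynomial (Fin n) K) : Prop :=
  IsTameShift (pairTuple p q (f • genBracket K p q))

theorem isTameCohn_zero (p q : Fin n) : IsTameCohn p q (0 : MvPolynomial (Fin n) K) :=
  isTameShift_of_xg (φ := 1) (one_mem _) fun i => by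
    rw [zero_smul, pairTuple, smul_zero, smul_zero, Pi.single_zero, Pi.single_zero, add_zero]
    exact (add_zero _).symm

theorem IsTameCohn.add {p q : Fin n} (hpq : p ≠ q) {f g : MvPolynomial (Fin n) K}
    (hf : IsTameCohn p q f) (hg : IsTameCohn p q g) : IsTameCohn p q (f + g) := by
  have := IsTameShift.add hf hg fun t => by
    rw [shiftDerived_pairTuple, map_smul, shiftDerived_pairTuple_genBracket hpq]
  rw [IsTameCohn, add_smul, show pairTuple p q _ = _ from funext (pairTuple_add p q _ _)]
  exact this

theorem isTameCohn_X_mul_X_mul_of_ne (hK : (4 ≤ n ∧ ringChar K ≠ 3) ∨ 5 ≤ n) {p q r s : Fin n}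
    (hpq : p ≠ q) (hrp : r ≠ p) (hrq : r ≠ q) (hsp : s ≠ p) (hsq : s ≠ q) (hrs : r ≠ s)
    (h : MvPolynomial (Fin n) K) : IsTameCohn p q (X r * X s * h) := by
  set u : derivedIdeal K n := (X r * h) • genBracket K r s with hu
  have hpu : IsTameShift (Pi.single p ((X p : MvPolynomial (Fin n) K) • u)) := by
    rw [hu, smul_smul, mul_left_comm]
    exact isTameShift_single_X_mul hK hrp hsp hrp _
  have hqu : IsTameShift (Pi.single q ((X q : MvPolynomial (Fin n) K) • u)) := by
    rw [hu, smul_smul, mul_left_comm]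
    exact isTameShift_single_X_mul hK hrq hsq hrq _
  have hpair : IsTameShift (pairTuple p q u) := by
    refine hpu.add hqu fun t => ?_
    rw [shiftDerived_piSingle, shiftDerived_single_of_mem]
    exact Submodule.smul_mem _ _ (Submodule.smul_mem _ _ (genBracket_mem_bracketsAvoiding hrp hsp))
  have hr : IsTameShift (Pi.single r (genBracket K p q)) := by
    simpa using isTameShift_single_of_mem_supported hrp.symm hrq.symm
      (one_mem (supported K {j | j ≠ r}))
  have hmem : genBracket K p q ∈ bracketsAvoiding K r :=
    genBracket_mem_bracketsAvoiding hrp.symm hrq.symm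
  have hval : shiftDerived (Pi.single r (genBracket K p q)) u =
      (X r * X s * h) • genBracket K p q + u := by
    rw [hu, map_smul, shiftDerived_genBracket, Pi.single_eq_same, Pi.single_eq_of_ne hrs.symm]
    module
  have hfix (v : derivedIdeal K n) : shiftDerived (pairTuple p q v) u = u := by
    rw [hu, map_smul, shiftDerived_pairTuple_genBracket_of_ne hrp hrq hsp hsq]
  have := hr.commutator hpair
    (fun t => by rw [shiftDerived_piSingle, shiftDerived_single_of_mem _ hmem])
    (fun t => by rw [shiftDerived_piSingle, shiftDerived_pairTuple_genBracket hpq])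
    (fun t => by rw [shiftDerived_pairTuple, hfix])
    (fun t => by
      rw [shiftDerived_pairTuple, hval,
        show (fun i => -pairTuple p q u i) = pairTuple p q (-u) from
          funext fun i => (pairTuple_neg p q u i).symm,
        shiftDerived_pairTuple, map_add, map_smul, hfix, shiftDerived_pairTuple_genBracket hpq])
  rw [IsTameCohn]
  convert this using 1
  funext t
  rw [shiftDerived_pairTuple, hval, pairTuple_add, add_sub_cancel_right]

theorem IsTameCohn.map_polyTransvection (hK : (4 ≤ n ∧ ringChar K ≠ 3) ∨ 5 ≤ n) {p q a b : Fin n}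
    (hpq : p ≠ q) (hap : a ≠ p) (haq : a ≠ q) (hab : a ≠ b) {f : MvPolynomial (Fin n) K}
    (hf : IsTameCohn p q f) : IsTameCohn p q (polyTransvection K a b f) := by
  set u : derivedIdeal K n := polyTransvection K a b f • genBracket K p q with hu
  have hT (t : Fin n) : restrictDerived (transvection K a b)
      (pairTuple p q (f • genBracket K p q) t) = pairTuple p q u t := by
    have hT' : restrictDerived (transvection K a b) (f • genBracket K p q) = u := by
      rw [restrictDerived_transvection_smul, transvection_genBracket_of_ne hap.symm haq.symm]
    refine map_pairTuple (restrictDerived (transvection K a b) : _ →ₗ[K] _).toAddMonoidHom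
      ?_ ?_ t
    · change restrictDerived (transvection K a b) _ = _
      rw [restrictDerived_transvection_smul, hT', polyTransvection_X_of_ne hap.symm]
    · change restrictDerived (transvection K a b) _ = _
      rw [restrictDerived_transvection_smul, hT', polyTransvection_X_of_ne haq.symm]
  have hconj : IsTameShift fun t =>
      pairTuple p q u t - (Pi.single a (pairTuple p q u b) : Fin n → derivedIdeal K n) t := by
    convert IsTameShift.conj_transvection hf hab using 1
    funext t
    rw [map_sub, hT, ← hT b]
    congr 1
    exact (map_piSingle (restrictDerived (transvection K a b) : _ →ₗ[K] _).toAddMonoidHom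
      a _ t).symm
  have hsingle : IsTameShift (Pi.single a (pairTuple p q u b)) := by
    by_cases hbp : b = p
    · rw [hbp, pairTuple_left hpq, hu, smul_smul]
      exact isTameShift_single_X_mul hK hap.symm haq.symm hap.symm _
    by_cases hbq : b = q
    · rw [hbq, pairTuple_right hpq, hu, smul_smul]
      exact isTameShift_single_X_mul hK hap.symm haq.symm haq.symm _
    rw [pairTuple_of_ne hbp hbq]
    simpa using isTameShift_single_of_mem_supported (K := K) hap.symm haq.symm
      (zero_mem (supported K _))
  have := hconj.add hsingle fun t => by
    rw [shiftDerived_piSingle]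
    congr 1
    have h0 := shiftDerived_genBracket_eq_self (p := p) (q := q) (u := u) (m := fun t =>
      pairTuple p q u t - (Pi.single a (pairTuple p q u b) : Fin n → derivedIdeal K n) t)
      (by rw [Pi.single_eq_of_ne hap.symm, sub_zero, pairTuple_left hpq])
      (by rw [Pi.single_eq_of_ne haq.symm, sub_zero, pairTuple_right hpq])
    rw [shiftDerived_pairTuple]
    conv_lhs => rw [hu, map_smul]
    rw [h0]
  simp only [sub_add_cancel] at this
  exact this

theorem isTameCohn_X_mul_X_mul (hK : (4 ≤ n ∧ ringChar K ≠ 3) ∨ 5 ≤ n) {p q : Fin n}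
    (hpq : p ≠ q) (u v : Fin n) (h : MvPolynomial (Fin n) K) :
    IsTameCohn p q (X u * X v * h) := by
  have hn : 4 ≤ n := hK.elim (fun h => h.1) (fun h => by lia)
  have hex (t : Fin n) : ∃ s, s ≠ p ∧ s ≠ q ∧ s ≠ t := by
    obtain ⟨s, hs⟩ := Finset.exists_mem_notMem_of_card_lt_card (s := {p, q, t})
      (t := Finset.univ) (Finset.card_le_three.trans_lt (by simp; lia))
    exact ⟨s, by simpa using hs⟩
  have step {u s : Fin n} (hsp : s ≠ p) (hsq : s ≠ q) (hsu : s ≠ u)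
      (H : ∀ h : MvPolynomial (Fin n) K, IsTameCohn p q (X u * X s * h)) (v : Fin n)
      (h : MvPolynomial (Fin n) K) : IsTameCohn p q (X u * X v * h) := by
    by_cases hsv : s = v
    · exact hsv ▸ H h
    obtain ⟨g, rfl⟩ := polyTransvection_surjective hsv h
    have h1 := (H g).map_polyTransvection hK hpq hsp hsq hsv
    rw [map_mul, map_mul, polyTransvection_X_of_ne hsu.symm, polyTransvection_X_self] at h1
    convert h1.add hpq (H (-polyTransvection K s v g)) using 1
    ring
  have outside {u : Fin n} (hup : u ≠ p) (huq : u ≠ q) (v : Fin n)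
      (h : MvPolynomial (Fin n) K) : IsTameCohn p q (X u * X v * h) := by
    obtain ⟨s, hsp, hsq, hsu⟩ := hex u
    exact step hsp hsq hsu
      (isTameCohn_X_mul_X_mul_of_ne hK hpq hup huq hsp hsq hsu.symm) v h
  obtain ⟨s, hsp, hsq, hsu⟩ := hex u
  refine step hsp hsq hsu (fun g => ?_) v h
  rw [mul_comm (X u)]
  exact outside hsp hsq u g

theorem exists_monomial_eq_X_mul_X_mul {d : Fin n →₀ ℕ} (hd : 2 ≤ ∑ i, d i) (c : K) :
    ∃ (u v : Fin n) (h : MvPolynomial (Fin n) K), monomial d c = X u * X v * h := by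
  have hsplit {d : Fin n →₀ ℕ} (hd : 0 < ∑ i, d i) :
      ∃ (u : Fin n) (e : Fin n →₀ ℕ), d = Finsupp.single u 1 + e := by
    obtain ⟨u, -, hu⟩ := Finset.exists_ne_zero_of_sum_ne_zero hd.ne'
    exact ⟨u, d - Finsupp.single u 1,
      (add_tsub_cancel_of_le (Finsupp.single_le_iff.2 (Nat.one_le_iff_ne_zero.2 hu))).symm⟩
  obtain ⟨u, e, rfl⟩ := hsplit (by lia : 0 < ∑ i, d i)
  have he : 0 < ∑ i, e i := by
    simp only [Finsupp.add_apply, Finset.sum_add_distrib, Finsupp.single_apply,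
      Finset.sum_ite_eq, Finset.mem_univ, if_true] at hd
    lia
  obtain ⟨v, e', rfl⟩ := hsplit he
  refine ⟨u, v, monomial e' c, ?_⟩
  rw [X, X, monomial_mul, monomial_mul, one_mul, one_mul, add_assoc]

theorem isTameCohn_of_polyLdegGE (hK : (4 ≤ n ∧ ringChar K ≠ 3) ∨ 5 ≤ n) {p q : Fin n}
    (hpq : p ≠ q) {a : MvPolynomial (Fin n) K} (ha : PolyLdegGE K n a 2) : IsTameCohn p q a := by
  rw [a.as_sum]
  refine Finset.sum_induction _ (IsTameCohn p q) (fun _ _ => IsTameCohn.add hpq)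
    (isTameCohn_zero p q) fun d hd => ?_
  obtain ⟨u, v, h, e⟩ := exists_monomial_eq_X_mul_X_mul (ha d hd) (a.coeff d)
  rw [e]
  exact isTameCohn_X_mul_X_mul hK hpq u v h

end Tameness

/-- **Lemma 5.** Over a field `K`, with `n ≥ 4` and `char K ≠ 3`, or `n ≥ 5`, for every
`a ∈ U = K[y₁,…,yₙ]` of lower degree `≥ 2`, the automorphism
`D(a) = (x₁ + [x₁,x₂]y₁a, x₂ + [x₁,x₂]y₂a, x₃, …, xₙ)` of `Mₙ` is tame. -/
theorem D_a_is_tame (K : Type) [Field K] (n : ℕ) (hn : 0 < n)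
    (hK : (4 ≤ n ∧ ringChar K ≠ 3) ∨ 5 ≤ n)
    (a : MvPolynomial (Fin n) K) (ha : PolyLdegGE K n a 2)
    (i0 i1 : Fin n) (h0 : (i0 : ℕ) = 0) (h1 : (i1 : ℕ) = 1)
    (φ : FreeMetabelianLie K n ≃ₗ⁅K⁆ FreeMetabelianLie K n)
    (hφ0 : φ (xg K n i0) = xg K n i0 +
      polyAct K n (MvPolynomial.X i0 * a) ⁅xg K n i0, xg K n i1⁆)
    (hφ1 : φ (xg K n i1) = xg K n i1 +
      polyAct K n (MvPolynomial.X i1 * a) ⁅xg K n i0, xg K n i1⁆)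
    (hφ : ∀ j : Fin n, j ≠ i0 → j ≠ i1 → φ (xg K n j) = xg K n j) :
    IsTame K n φ := by
  have h01 : i0 ≠ i1 := fun h => by
    rw [h, h1] at h0
    exact one_ne_zero h0
  refine (isTameCohn_of_polyLdegGE hK h01 ha).isTame fun i => ?_
  have hpoly (j : Fin n) : polyAct K n (X j * a) ⁅xg K n i0, xg K n i1⁆ =
      ((X j : MvPolynomial (Fin n) K) • a • genBracket K i0 i1 : derivedIdeal K n) := by
    rw [smul_smul]
    exact polyAct_eq_smul _ (genBracket K i0 i1)
  by_cases hi0 : i = i0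
  · rw [hi0, hφ0, pairTuple_left h01, hpoly]
  by_cases hi1 : i = i1
  · rw [hi1, hφ1, pairTuple_right h01, hpoly]
  rw [hφ i hi0 hi1, pairTuple_of_ne hi0 hi1, LieSubmodule.coe_zero, add_zero]
end

section
/- Let $K$ be any field and $n\geq 4$. Then for every $a\in U=K[y_1,\ldots,y_n]$ with $\mathrm{ldeg}(a)\geq 1$ (i.e., $a$ has zero constant term), the automorphism $D(a)=(x_1+[x_1,x_2]y_1a,\ x_2+[x_1,x_2]y_2a,\ x_3,\ldots,x_n)$ of $M_n$ is almost tame. -/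
namespace FreeMetabelianLie

noncomputable section

open MvPolynomial

variable {K : Type} [Field K] {n : ℕ}

variable (K n) in
/-- The canonical projection from the free Lie algebra, as a morphism of Lie algebras. -/
def proj : FreeLieAlgebra K (Fin n) →ₗ⁅K⁆ FreeMetabelianLie K n where
  toFun := LieSubmodule.Quotient.mk
  map_add' _ _ := rfl
  map_smul' _ _ := rfl
  map_lie' := rfl

theorem proj_surjective : Function.Surjective (proj K n) :=
  Submodule.Quotient.mk_surjective _

theorem derivedSeries_two :
    LieAlgebra.derivedSeries K (FreeMetabelianLie K n) 2 = ⊥ := by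
  rw [← LieIdeal.derivedSeries_map_eq 2 proj_surjective, eq_bot_iff, LieIdeal.map_le]
  rintro _ ⟨x, hx, rfl⟩
  exact (LieSubmodule.Quotient.mk_eq_zero' (m := x)).mpr hx

variable (K n) in
/-- The derived ideal `[M, M]`, as a subspace. -/
def derivedSub : Submodule K (FreeMetabelianLie K n) :=
  (LieAlgebra.derivedSeries K (FreeMetabelianLie K n) 1).toSubmodule

theorem lie_mem_derivedSub (x y : FreeMetabelianLie K n) : ⁅x, y⁆ ∈ derivedSub K n :=
  LieSubmodule.lie_mem_lie (I := ⊤) (N := ⊤) trivial trivial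

theorem lie_derivedSub {x y : FreeMetabelianLie K n} (hx : x ∈ derivedSub K n)
    (hy : y ∈ derivedSub K n) : ⁅x, y⁆ = 0 := by
  have h : ⁅x, y⁆ ∈ LieAlgebra.derivedSeries K (FreeMetabelianLie K n) 2 :=
    LieSubmodule.lie_mem_lie hx hy
  rw [derivedSeries_two] at h
  exact h

theorem map_mem_derivedSub (f : FreeMetabelianLie K n →ₗ⁅K⁆ FreeMetabelianLie K n)
    {x : FreeMetabelianLie K n} (hx : x ∈ derivedSub K n) : f x ∈ derivedSub K n :=
  LieIdeal.derivedSeries_map_le 1 (f := f) (LieIdeal.mem_map hx)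

theorem hom_ext {f g : FreeMetabelianLie K n →ₗ⁅K⁆ FreeMetabelianLie K n}
    (h : ∀ i, f (xg K n i) = g (xg K n i)) : f = g := by
  have : f.comp (proj K n) = g.comp (proj K n) := FreeLieAlgebra.hom_ext h
  ext x
  obtain ⟨y, rfl⟩ := proj_surjective x
  exact DFunLike.congr_fun this y

theorem aut_ext {f g : FreeMetabelianLie K n ≃ₗ⁅K⁆ FreeMetabelianLie K n}
    (h : ∀ i, f (xg K n i) = g (xg K n i)) : f = g := by
  have : f.toLieHom = g.toLieHom := hom_ext h
  exact LieEquiv.ext fun x => DFunLike.congr_fun this x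

/-- The endomorphism of the free metabelian Lie algebra sending each `xᵢ` to `z i`. -/
def endo (z : Fin n → FreeMetabelianLie K n) :
    FreeMetabelianLie K n →ₗ⁅K⁆ FreeMetabelianLie K n :=
  have h : LieAlgebra.derivedSeries K (FreeLieAlgebra K (Fin n)) 2 ≤
      (FreeLieAlgebra.lift K z).ker := by
    rw [LieHom.le_ker_iff]
    intro x hx
    have := LieIdeal.derivedSeries_map_le 2 (f := FreeLieAlgebra.lift K z) (LieIdeal.mem_map hx)
    rw [derivedSeries_two] at this
    exact this
  { (Submodule.liftQ _ (FreeLieAlgebra.lift K z).toLinearMap (fun _ hx => h hx) :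
      FreeMetabelianLie K n →ₗ[K] FreeMetabelianLie K n) with
    map_lie' := by
      intro x y
      obtain ⟨x, rfl⟩ := proj_surjective x
      obtain ⟨y, rfl⟩ := proj_surjective y
      rw [← LieHom.map_lie]
      exact (FreeLieAlgebra.lift K z).map_lie x y }

@[simp]
theorem endo_xg (z : Fin n → FreeMetabelianLie K n) (i : Fin n) : endo z (xg K n i) = z i :=
  FreeLieAlgebra.lift_of_apply z i

/-- The automorphism built from two mutually inverse endomorphisms. -/
def autOfHom (f g : FreeMetabelianLie K n →ₗ⁅K⁆ FreeMetabelianLie K n)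
    (hfg : ∀ i, f (g (xg K n i)) = xg K n i) (hgf : ∀ i, g (f (xg K n i)) = xg K n i) :
    FreeMetabelianLie K n ≃ₗ⁅K⁆ FreeMetabelianLie K n :=
  { f with
    invFun := g
    left_inv := DFunLike.congr_fun (hom_ext (f := g.comp f) (g := LieHom.id) hgf)
    right_inv := DFunLike.congr_fun (hom_ext (f := f.comp g) (g := LieHom.id) hfg) }

/-- The restriction of an endomorphism to the derived ideal. -/
def mapDerived (f : FreeMetabelianLie K n →ₗ⁅K⁆ FreeMetabelianLie K n) :
    derivedSub K n →ₗ[K] derivedSub K n :=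
  (f : FreeMetabelianLie K n →ₗ[K] FreeMetabelianLie K n).restrict
    fun _ => map_mem_derivedSub f

@[simp]
theorem coe_mapDerived (f : FreeMetabelianLie K n →ₗ⁅K⁆ FreeMetabelianLie K n)
    (m : derivedSub K n) : (mapDerived f m : FreeMetabelianLie K n) = f m := rfl

/-- The commutator `[xᵢ, xⱼ]` as an element of the derived ideal. -/
def comm (i j : Fin n) : derivedSub K n := ⟨⁅xg K n i, xg K n j⁆, lie_mem_derivedSub _ _⟩

/-- The operator `m ↦ [m, xᵢ]` on the derived ideal. -/
def shift (i : Fin n) : Module.End K (derivedSub K n) :=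
  (-(LieAlgebra.ad K (FreeMetabelianLie K n) (xg K n i))).restrict fun x _ => by
    rw [LinearMap.neg_apply, LieAlgebra.ad_apply, lie_skew]
    exact lie_mem_derivedSub _ _

theorem coe_shift (i : Fin n) (m : derivedSub K n) :
    (shift i m : FreeMetabelianLie K n) = ⁅(m : FreeMetabelianLie K n), xg K n i⁆ := by
  rw [← lie_skew]
  rfl

theorem shift_comm (i j : Fin n) :
    (shift i * shift j : Module.End K (derivedSub K n)) = shift j * shift i := by
  ext m
  have h := leibniz_lie (m : FreeMetabelianLie K n) (xg K n i) (xg K n j)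
  rw [lie_derivedSub m.2 (lie_mem_derivedSub _ _), ← lie_skew (xg K n i), ← sub_eq_add_neg] at h
  simp only [Module.End.mul_apply, coe_shift]
  exact (sub_eq_zero.mp h.symm).symm

theorem shift_shift (i j : Fin n) (m : derivedSub K n) :
    shift i (shift j m) = shift j (shift i m) :=
  DFunLike.congr_fun (shift_comm i j) m

open scoped IsMulCommutative in
/-- The action of `U = K[y₁, …, yₙ]` on the derived ideal. -/
def act : MvPolynomial (Fin n) K →ₐ[K] Module.End K (derivedSub K n) :=
  let S := Algebra.adjoin K (Set.range (shift (K := K) (n := n)))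
  have : IsMulCommutative S := Algebra.isMulCommutative_adjoin K (by
    rintro _ ⟨i, rfl⟩ _ ⟨j, rfl⟩
    exact shift_comm i j)
  S.val.comp (aeval (R := K) (S₁ := S) fun i => ⟨shift i, Algebra.subset_adjoin ⟨i, rfl⟩⟩)

@[simp]
theorem act_X (i : Fin n) : act (X i) = shift (K := K) i := by
  simp [act]

theorem act_mul_apply (a b : MvPolynomial (Fin n) K) (m : derivedSub K n) :
    act (a * b) m = act a (act b m) := by
  rw [map_mul, Module.End.mul_apply]

theorem act_monomial (d : Fin n →₀ ℕ) (r : K) :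
    act (monomial d r) = r • (List.ofFn fun i : Fin n => shift (K := K) i ^ d i).prod := by
  have : (monomial d r : MvPolynomial (Fin n) K) =
      r • (List.ofFn fun i : Fin n => X i ^ d i).prod := by
    rw [List.prod_ofFn, monomial_eq, Finsupp.prod_fintype _ _ (by simp), smul_eq_C_mul]
  rw [this, map_smul, map_list_prod, List.map_ofFn]
  congr
  ext
  simp

theorem coe_prod_shift (l : List (Fin n × ℕ)) (m : derivedSub K n) :
    (((l.map fun p => shift (K := K) p.1 ^ p.2).prod m : derivedSub K n) :
      FreeMetabelianLie K n) =
    (l.map fun p => (-(LieAlgebra.ad K (FreeMetabelianLie K n) (xg K n p.1))) ^ p.2).prod m := by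
  induction l with
  | nil => rfl
  | cons p l ih =>
    rw [List.map_cons, List.map_cons, List.prod_cons, List.prod_cons, Module.End.mul_apply,
      Module.End.mul_apply, ← ih]
    generalize (List.map (fun p => shift p.1 ^ p.2) l).prod m = w
    induction p.2 with
    | zero => rfl
    | succ k ihk =>
      rw [pow_succ', pow_succ', Module.End.mul_apply, Module.End.mul_apply, ← ihk]
      rfl

theorem polyAct_eq_act (a : MvPolynomial (Fin n) K) (m : derivedSub K n) :
    polyAct K n a m = act a m := by
  conv_rhs => rw [a.as_sum]
  rw [map_sum, LinearMap.sum_apply, Submodule.coe_sum]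
  refine Finset.sum_congr rfl fun d _ => ?_
  rw [act_monomial, LinearMap.smul_apply, Submodule.coe_smul]
  have := coe_prod_shift (List.ofFn fun i : Fin n => (i, d i)) m
  rw [List.map_ofFn, List.map_ofFn] at this
  exact congrArg _ this.symm

theorem mapDerived_act (f : FreeMetabelianLie K n →ₗ⁅K⁆ FreeMetabelianLie K n)
    (θ : MvPolynomial (Fin n) K →ₐ[K] MvPolynomial (Fin n) K)
    (h : ∀ i m, mapDerived f (act (X i) m) = act (θ (X i)) (mapDerived f m))
    (a : MvPolynomial (Fin n) K) (m : derivedSub K n) :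
    mapDerived f (act a m) = act (θ a) (mapDerived f m) := by
  induction a using MvPolynomial.induction_on generalizing m with
  | C r => simp [← algebraMap_eq]
  | add p q hp hq => simp [hp, hq]
  | mul_X p i hp => rw [act_mul_apply, hp, h, map_mul, act_mul_apply]

/-- The endomorphism `xᵢ ↦ xᵢ + [xⱼ, xₖ] pᵢ`. -/
def transHom (j k : Fin n) (p : Fin n → MvPolynomial (Fin n) K) :
    FreeMetabelianLie K n →ₗ⁅K⁆ FreeMetabelianLie K n :=
  endo fun i => xg K n i + act (p i) (comm j k)

theorem transHom_xg (j k : Fin n) (p : Fin n → MvPolynomial (Fin n) K) (i : Fin n) :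
    transHom j k p (xg K n i) = xg K n i + act (p i) (comm j k) := endo_xg _ _

theorem transHom_act (j k : Fin n) (p : Fin n → MvPolynomial (Fin n) K)
    (a : MvPolynomial (Fin n) K) (m : derivedSub K n) :
    mapDerived (transHom j k p) (act a m) = act a (mapDerived (transHom j k p) m) := by
  refine mapDerived_act _ (AlgHom.id K _) (fun i m => Subtype.ext ?_) a m
  simp only [AlgHom.id_apply, act_X, coe_mapDerived, coe_shift, LieHom.map_lie, transHom_xg,
    lie_add]
  rw [lie_derivedSub (map_mem_derivedSub _ m.2) (act (p i) (comm j k)).2, add_zero]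

theorem transHom_comm (j k : Fin n) (p : Fin n → MvPolynomial (Fin n) K) (r s : Fin n) :
    mapDerived (transHom j k p) (comm r s) =
      comm r s + act (X s * p r - X r * p s) (comm j k) := by
  refine Subtype.ext ?_
  rw [map_sub, LinearMap.sub_apply, act_mul_apply, act_mul_apply, act_X, act_X]
  simp only [coe_mapDerived, Submodule.coe_add, Submodule.coe_sub, coe_shift]
  rw [comm, LieHom.map_lie, transHom_xg, transHom_xg, add_lie, lie_add, lie_add,
    lie_derivedSub (act (p r) (comm j k)).2 (act (p s) (comm j k)).2,
    ← lie_skew (xg K n r) (act (p s) (comm j k) : FreeMetabelianLie K n)]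
  abel

theorem transHom_transHom_xg {j k : Fin n} {p : Fin n → MvPolynomial (Fin n) K}
    (hp : X k * p j = X j * p k) (q : Fin n → MvPolynomial (Fin n) K) (i : Fin n) :
    transHom j k p (transHom j k q (xg K n i)) = xg K n i + act (p i + q i) (comm j k) := by
  rw [transHom_xg, map_add, transHom_xg, ← coe_mapDerived, transHom_act, transHom_comm,
    hp, sub_self, map_zero, LinearMap.zero_apply, add_zero, map_add, LinearMap.add_apply,
    Submodule.coe_add, add_assoc]

/-- The automorphism `xᵢ ↦ xᵢ + [xⱼ, xₖ] pᵢ`, where `yₖ pⱼ = yⱼ pₖ`. -/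
def trans (j k : Fin n) (p : Fin n → MvPolynomial (Fin n) K) (hp : X k * p j = X j * p k) :
    FreeMetabelianLie K n ≃ₗ⁅K⁆ FreeMetabelianLie K n :=
  autOfHom (transHom j k p) (transHom j k (-p))
    (fun i => by simp [transHom_transHom_xg hp])
    (fun i => by
      rw [transHom_transHom_xg (by simp [hp])]
      simp)

theorem trans_xg (j k : Fin n) (p : Fin n → MvPolynomial (Fin n) K)
    (hp : X k * p j = X j * p k) (i : Fin n) :
    trans j k p hp (xg K n i) = xg K n i + act (p i) (comm j k) := transHom_xg _ _ _ _

theorem trans_act_comm (j k : Fin n) (p : Fin n → MvPolynomial (Fin n) K)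
    (hp : X k * p j = X j * p k) (a : MvPolynomial (Fin n) K) (r s : Fin n) :
    trans j k p hp (act a (comm r s) : derivedSub K n) =
      (act a (comm r s) : derivedSub K n) +
        (act (a * (X s * p r - X r * p s)) (comm j k) : FreeMetabelianLie K n) := by
  change transHom j k p _ = _
  rw [← coe_mapDerived, transHom_act, transHom_comm, map_add, act_mul_apply, Submodule.coe_add]

theorem trans_act_comm_self (j k : Fin n) (p : Fin n → MvPolynomial (Fin n) K)
    (hp : X k * p j = X j * p k) (a : MvPolynomial (Fin n) K) :
    trans j k p hp (act a (comm j k) : derivedSub K n) = (act a (comm j k) : derivedSub K n) := by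
  rw [trans_act_comm, hp, sub_self, mul_zero, map_zero, LinearMap.zero_apply, Submodule.coe_zero,
    add_zero]

theorem mul_apply (f g : FreeMetabelianLie K n ≃ₗ⁅K⁆ FreeMetabelianLie K n)
    (x : FreeMetabelianLie K n) : (f * g) x = f (g x) := rfl

theorem trans_mul (j k : Fin n) (p q : Fin n → MvPolynomial (Fin n) K)
    (hp : X k * p j = X j * p k) (hq : X k * q j = X j * q k) :
    trans j k p hp * trans j k q hq = trans j k (p + q) (by simp [mul_add, hp, hq]) := by
  refine aut_ext fun i => ?_
  rw [trans_xg]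
  exact transHom_transHom_xg hp q i

theorem isAlmostTame_mul {f g : FreeMetabelianLie K n ≃ₗ⁅K⁆ FreeMetabelianLie K n}
    (hf : IsAlmostTame K n f) (hg : IsAlmostTame K n g) : IsAlmostTame K n (f * g) :=
  Subgroup.mul_mem _ hf hg

theorem isAlmostTame_trans_single (j k i : Fin n) (a : MvPolynomial (Fin n) K)
    (h : X k * (Pi.single i a : Fin n → MvPolynomial (Fin n) K) j =
      X j * (Pi.single i a : Fin n → MvPolynomial (Fin n) K) k) :
    IsAlmostTame K n (trans j k (Pi.single i a) h) := by
  refine Subgroup.subset_closure ⟨i, fun r hr => ?_⟩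
  rw [trans_xg, Pi.single_eq_of_ne hr]
  simp

/-- The row `(y₁ a, y₂ a, 0, …, 0)`, with the first two indices replaced by `j` and `k`. -/
def twoRow (j k : Fin n) (a : MvPolynomial (Fin n) K) : Fin n → MvPolynomial (Fin n) K :=
  fun i => if i = j ∨ i = k then X i * a else 0

theorem twoRow_left (j k : Fin n) (a : MvPolynomial (Fin n) K) : twoRow j k a j = X j * a := by
  simp [twoRow]

theorem twoRow_right (j k : Fin n) (a : MvPolynomial (Fin n) K) : twoRow j k a k = X k * a := by
  simp [twoRow]

theorem twoRow_of_ne {j k i : Fin n} (hj : i ≠ j) (hk : i ≠ k) (a : MvPolynomial (Fin n) K) :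
    twoRow j k a i = 0 := by
  simp [twoRow, hj, hk]

/-- The automorphism `D(a) = (x₁ + [x₁, x₂] y₁ a, x₂ + [x₁, x₂] y₂ a, x₃, …, xₙ)`, with the
first two indices replaced by `j` and `k`. -/
def autD (j k : Fin n) (a : MvPolynomial (Fin n) K) :
    FreeMetabelianLie K n ≃ₗ⁅K⁆ FreeMetabelianLie K n :=
  trans j k (twoRow j k a) (by rw [twoRow_left, twoRow_right]; ring)

theorem autD_mul (j k : Fin n) (a b : MvPolynomial (Fin n) K) :
    autD j k a * autD j k b = autD j k (a + b) := by
  rw [autD, autD, trans_mul]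
  congr
  ext1 i
  by_cases h : i = j ∨ i = k <;> simp [twoRow, h, mul_add]

theorem isAlmostTame_autD_X_mul_of_ne {j k l r : Fin n} (hlj : l ≠ j) (hlk : l ≠ k)
    (hrj : r ≠ j) (hrk : r ≠ k) (hlr : l ≠ r) (hjk : j ≠ k) (b : MvPolynomial (Fin n) K) :
    IsAlmostTame K n (autD j k (X l * b)) := by
  have hA : ∀ i a, i ≠ l → i ≠ r →
      X r * (Pi.single i a : Fin n → MvPolynomial (Fin n) K) l =
      X l * (Pi.single i a : Fin n → MvPolynomial (Fin n) K) r := fun i a h h' => by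
    rw [Pi.single_eq_of_ne h.symm, Pi.single_eq_of_ne h'.symm, mul_zero, mul_zero]
  let A := trans l r _ (hA j (X j) hlj.symm hrj.symm) * trans l r _ (hA k (X k) hlk.symm hrk.symm)
  have hAt : IsAlmostTame K n A :=
    isAlmostTame_mul (isAlmostTame_trans_single _ _ _ _ _) (isAlmostTame_trans_single _ _ _ _ _)
  let B := trans j k (Pi.single r b) (by
    rw [Pi.single_eq_of_ne hrj.symm, Pi.single_eq_of_ne hrk.symm, mul_zero, mul_zero])
  have hBt : IsAlmostTame K n B := isAlmostTame_trans_single _ _ _ _ _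
  have key : autD j k (X l * b) * (B * A) = A * B := by
    simp only [A, B, trans_mul]
    refine aut_ext fun i => ?_
    simp only [autD, mul_apply, trans_xg, map_add, trans_act_comm]
    by_cases hij : i = j
    · subst hij
      simp [twoRow, hlj, hlk, hrj, hrk, hlr, hjk, hrj.symm, hjk.symm, shift_shift i k]
      abel
    by_cases hik : i = k
    · subst hik
      simp [twoRow, hlj, hlk, hrj, hrk, hlr, hjk, hrk.symm, hjk.symm, shift_shift i j]
      abel
    by_cases hir : i = r
    · subst hir
      simp [twoRow, hlj, hlk, hrj, hrk, hlr, hjk, hjk.symm, shift_shift k j]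
    simp [twoRow, Ne.symm hir, hij, hik]
  rw [eq_mul_inv_of_mul_eq key]
  exact Subgroup.mul_mem _ (isAlmostTame_mul hAt hBt)
    (Subgroup.inv_mem _ (isAlmostTame_mul hBt hAt))

/-- The linear endomorphism `xₗ ↦ xₗ + s xₜ` fixing the other generators. -/
def linHom (l t : Fin n) (s : K) : FreeMetabelianLie K n →ₗ⁅K⁆ FreeMetabelianLie K n :=
  endo fun i => xg K n i + if i = l then s • xg K n t else 0

theorem linHom_xg_self (l t : Fin n) (s : K) :
    linHom l t s (xg K n l) = xg K n l + s • xg K n t := by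
  simp [linHom]

theorem linHom_xg_of_ne {l i : Fin n} (h : i ≠ l) (t : Fin n) (s : K) :
    linHom l t s (xg K n i) = xg K n i := by
  simp [linHom, h]

/-- The substitution `yₗ ↦ yₗ + s yₜ`. -/
def linSubst (l t : Fin n) (s : K) : MvPolynomial (Fin n) K →ₐ[K] MvPolynomial (Fin n) K :=
  aeval fun i => X i + if i = l then s • X t else 0

theorem linSubst_X_self (l t : Fin n) (s : K) : linSubst l t s (X l) = X l + s • X t := by
  simp [linSubst]

theorem linSubst_X_of_ne {l i : Fin n} (h : i ≠ l) (t : Fin n) (s : K) :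
    linSubst l t s (X i) = X i := by
  simp [linSubst, h]

theorem linSubst_linSubst_neg {l t : Fin n} (h : t ≠ l) (s : K) (a : MvPolynomial (Fin n) K) :
    linSubst l t s (linSubst l t (-s) a) = a := by
  have : (linSubst l t s).comp (linSubst l t (-s)) = AlgHom.id K _ := by
    refine MvPolynomial.algHom_ext fun i => ?_
    by_cases hi : i = l
    · subst hi
      simp [linSubst_X_self, linSubst_X_of_ne h]
    · simp [linSubst_X_of_ne hi]
  exact DFunLike.congr_fun this a

theorem linHom_act (l t : Fin n) (s : K) (a : MvPolynomial (Fin n) K) (m : derivedSub K n) :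
    mapDerived (linHom l t s) (act a m) =
      act (linSubst l t s a) (mapDerived (linHom l t s) m) := by
  refine mapDerived_act _ _ (fun i m => Subtype.ext ?_) a m
  by_cases hi : i = l
  · subst hi
    simp [linSubst_X_self, coe_shift, linHom_xg_self]
  · simp [linSubst_X_of_ne hi, coe_shift, linHom_xg_of_ne hi]

/-- The linear automorphism `xₗ ↦ xₗ + xₜ` fixing the other generators. -/
def linAut {l t : Fin n} (h : t ≠ l) : FreeMetabelianLie K n ≃ₗ⁅K⁆ FreeMetabelianLie K n :=
  have key : ∀ (s : K) i, linHom l t s (linHom l t (-s) (xg K n i)) = xg K n i := fun s i => by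
    by_cases hi : i = l
    · subst hi
      simp [linHom_xg_self, linHom_xg_of_ne h]
    · simp [linHom_xg_of_ne hi]
  autOfHom (linHom l t 1) (linHom l t (-1)) (key 1) (by simpa using key (-1))

theorem linAut_xg_self {l t : Fin n} (h : t ≠ l) :
    linAut h (xg K n l) = xg K n l + xg K n t :=
  (linHom_xg_self l t 1).trans (by rw [one_smul])

theorem linAut_xg_of_ne {l t i : Fin n} (h : t ≠ l) (hi : i ≠ l) :
    linAut h (xg K n i) = xg K n i :=
  linHom_xg_of_ne hi t 1

theorem isAlmostTame_linAut {l t : Fin n} (h : t ≠ l) : IsAlmostTame K n (linAut h) :=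
  Subgroup.subset_closure ⟨l, fun _ hr => linAut_xg_of_ne h hr⟩

theorem linAut_act_comm {l t j k : Fin n} (h : t ≠ l) (hj : j ≠ l) (hk : k ≠ l)
    (a : MvPolynomial (Fin n) K) :
    linAut h (act a (comm j k) : derivedSub K n) =
      ((act (linSubst l t 1 a) (comm j k) : derivedSub K n) : FreeMetabelianLie K n) := by
  change linHom l t 1 _ = _
  rw [← coe_mapDerived, linHom_act]
  congr 2
  refine Subtype.ext ?_
  rw [coe_mapDerived, comm, LieHom.map_lie, linHom_xg_of_ne hj, linHom_xg_of_ne hk]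

theorem isAlmostTame_autD_X_mul {j k l t : Fin n} (hlj : l ≠ j) (hlk : l ≠ k)
    (ht : t = j ∨ t = k) (h : ∀ b, IsAlmostTame K n (autD j k (X l * b)))
    (b : MvPolynomial (Fin n) K) : IsAlmostTame K n (autD j k (X t * b)) := by
  have htl : t ≠ l := by rintro rfl; tauto
  let c := X t * ((X l + X t) * b)
  let C := trans j k (Pi.single l (-c)) (by
    rw [Pi.single_eq_of_ne hlj.symm, Pi.single_eq_of_ne hlk.symm, mul_zero, mul_zero])
  have hC : IsAlmostTame K n C := isAlmostTame_trans_single _ _ _ _ _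
  have key : autD j k ((X l + X t) * b) * (C * linAut htl) =
      linAut htl * autD j k (X l * linSubst l t (-1) b) := by
    refine aut_ext fun i => ?_
    by_cases hi : i = l
    · subst hi
      simp only [autD, C, c, mul_apply, trans_xg, linAut_xg_self, map_add, Pi.single_eq_same,
        Pi.single_eq_of_ne htl, trans_act_comm_self, twoRow, hlj, hlk, ht]
      simp
      abel
    · simp only [autD, C, c, mul_apply, trans_xg, linAut_xg_of_ne htl hi, map_add,
        Pi.single_eq_of_ne hi, linAut_act_comm htl hlj.symm hlk.symm]
      by_cases hi' : i = j ∨ i = k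
      · simp only [twoRow, hi', if_true, map_mul, linSubst_X_self, linSubst_X_of_ne hi,
          linSubst_linSubst_neg htl, one_smul]
        simp
      · simp [twoRow, hi']
  have hsum : IsAlmostTame K n (autD j k ((X l + X t) * b)) := by
    rw [eq_mul_inv_of_mul_eq key]
    exact Subgroup.mul_mem _ (isAlmostTame_mul (isAlmostTame_linAut htl) (h _))
      (Subgroup.inv_mem _ (isAlmostTame_mul hC (isAlmostTame_linAut htl)))
  have : X t * b = X l * -b + (X l + X t) * b := by ring
  rw [this, ← autD_mul]
  exact isAlmostTame_mul (h _) hsum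

theorem isAlmostTame_autD (hn : 4 ≤ n) {j k : Fin n} (hjk : j ≠ k)
    {a : MvPolynomial (Fin n) K} (ha : PolyLdegGE K n a 1) : IsAlmostTame K n (autD j k a) := by
  have hcard : ∀ s : Finset (Fin n), s.card < n → ∃ l, l ∉ s := fun s hs => by
    by_contra! hall
    rw [Finset.eq_univ_of_forall hall, Finset.card_univ, Fintype.card_fin] at hs
    exact lt_irrefl _ hs
  have hout : ∀ l, l ≠ j → l ≠ k → ∀ b : MvPolynomial (Fin n) K,
      IsAlmostTame K n (autD j k (X l * b)) := fun l hlj hlk b => by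
    obtain ⟨r, hr⟩ := hcard {j, k, l} (Finset.card_le_three.trans_lt hn)
    simp only [Finset.mem_insert, Finset.mem_singleton, not_or] at hr
    exact isAlmostTame_autD_X_mul_of_ne hlj hlk hr.1 hr.2.1 (Ne.symm hr.2.2) hjk b
  obtain ⟨l, hl⟩ := hcard {j, k} (Finset.card_le_two.trans_lt (by omega))
  simp only [Finset.mem_insert, Finset.mem_singleton, not_or] at hl
  have hX : ∀ (t : Fin n) (b : MvPolynomial (Fin n) K),
      IsAlmostTame K n (autD j k (X t * b)) := fun t b => by
    by_cases ht : t = j ∨ t = k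
    · exact isAlmostTame_autD_X_mul hl.1 hl.2 ht (hout l hl.1 hl.2) b
    · rw [not_or] at ht
      exact hout t ht.1 ht.2 b
  have hmem : a ∈ Ideal.span (X '' Set.univ : Set (MvPolynomial (Fin n) K)) := by
    refine mem_ideal_span_X_image.mpr fun m hm => ?_
    by_contra! h0
    have := ha m hm
    rw [Finset.sum_eq_zero fun i _ => h0 i trivial] at this
    exact absurd this (by norm_num)
  suffices h : ∀ b, IsAlmostTame K n (autD j k (a * b)) by simpa using h 1
  clear ha
  induction hmem using Submodule.span_induction with
  | mem x hx =>
    obtain ⟨t, -, rfl⟩ := hx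
    exact hX t
  | zero => simpa using fun _ : MvPolynomial (Fin n) K => hX j 0
  | add x y _ _ hx hy =>
    intro b
    rw [add_mul, ← autD_mul]
    exact isAlmostTame_mul (hx b) (hy b)
  | smul r x _ hx =>
    intro b
    rw [smul_eq_mul, mul_comm r x, mul_assoc]
    exact hx (r * b)

end

end FreeMetabelianLie

/-- **Lemma 6.** Over any field `K`, for `n ≥ 4` and every `a ∈ U = K[y₁,…,yₙ]` of lower
degree `≥ 1` (zero constant term), the automorphism
`D(a) = (x₁ + [x₁,x₂]y₁a, x₂ + [x₁,x₂]y₂a, x₃, …, xₙ)` of `Mₙ` is almost tame. -/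
theorem D_a_is_almost_tame (K : Type) [Field K] (n : ℕ) (hn : 4 ≤ n)
    (a : MvPolynomial (Fin n) K) (ha : PolyLdegGE K n a 1)
    (i0 i1 : Fin n) (h0 : (i0 : ℕ) = 0) (h1 : (i1 : ℕ) = 1)
    (φ : FreeMetabelianLie K n ≃ₗ⁅K⁆ FreeMetabelianLie K n)
    (hφ0 : φ (xg K n i0) = xg K n i0 +
      polyAct K n (MvPolynomial.X i0 * a) ⁅xg K n i0, xg K n i1⁆)
    (hφ1 : φ (xg K n i1) = xg K n i1 +
      polyAct K n (MvPolynomial.X i1 * a) ⁅xg K n i0, xg K n i1⁆)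
    (hφ : ∀ j : Fin n, j ≠ i0 → j ≠ i1 → φ (xg K n j) = xg K n j) :
    IsAlmostTame K n φ := by
  have h01 : i0 ≠ i1 := fun h => by
    rw [h, h1] at h0
    exact one_ne_zero h0
  have key : φ = FreeMetabelianLie.autD i0 i1 a := by
    refine FreeMetabelianLie.aut_ext fun i => ?_
    rw [FreeMetabelianLie.autD, FreeMetabelianLie.trans_xg, ← FreeMetabelianLie.polyAct_eq_act]
    by_cases hi0 : i = i0
    · rw [hi0, hφ0, FreeMetabelianLie.twoRow_left]
      rfl
    by_cases hi1 : i = i1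
    · rw [hi1, hφ1, FreeMetabelianLie.twoRow_right]
      rfl
    rw [hφ i hi0 hi1, FreeMetabelianLie.twoRow_of_ne hi0 hi1]
    simp [polyAct]
  rw [key]
  exact FreeMetabelianLie.isAlmostTame_autD hn h01 ha
end
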